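/- Lifting proper intersections over an arbitrary base (affine form): let B be an integral domain, let A be a smooth B-algebra, and let I, I' be ideals of A such that A/I and A/I' are flat B-modules, every prime of A minimal over I has height at most j, and every prime of A minimal over I' has height at most j'. Let q be a prime ideal of B with residue field κ(q), and let x be a prime ideal of A containing I + I' and lying over q, such that in the fiber ring A_q := A ⊗_B κ(q) every prime minimal over the image of I + I' and contained in the image of x has height j + j'. Then for every prime ideal q' of B with q' ⊆ q: (1) there exists a prime ideal p of A with I + I' ⊆ p ⊆ x and p ∩ B = q'; (2) if moreover the image of x in A ⊗_B κ(q) is a maximal ideal, then p may be chosen so that its image generates a maximal ideal of A ⊗_B κ(q'). -/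

import Mathlib

/-- The height of an ideal of a commutative ring: for a prime ideal `p`, this is the
supremum of the lengths `r` of chains of primes `p₀ ⊊ p₁ ⊊ ⋯ ⊊ p_r = p`. -/
noncomputable def primeHt {S : Type*} [CommRing S] (p : Ideal S) : ℕ∞ :=
  ⨆ (h : p.IsPrime), Order.height (⟨p, h⟩ : PrimeSpectrum S)

/-- The canonical map from a `B`-algebra `A` to its fiber ring `A ⊗_B κ(q)` over a prime
`q` of `B`, where `κ(q) = Frac(B ⧸ q)` is the residue field of `q`. -/
noncomputable def fiberIncl (B A : Type u) [CommRing B] [CommRing A] [Algebra B A]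
    (q : Ideal B) : A →ₐ[B] TensorProduct B (FractionRing (B ⧸ q)) A :=
  Algebra.TensorProduct.includeRight

section Helpers
open Ideal TensorProduct

open Ideal

attribute [local instance] MvPolynomial.algebraMvPolynomial in
theorem isIntClosed_mvPoly {σ R : Type*} [CommRing R] [IsDomain R] [IsIntegrallyClosed R] :
    IsIntegrallyClosed (MvPolynomial σ R) := by
  let K := FractionRing R
  have : FaithfulSMul (MvPolynomial σ R) (MvPolynomial σ K) := by
    rw [faithfulSMul_iff_algebraMap_injective]
    exact MvPolynomial.map_injective _ (IsFractionRing.injective R K)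
  have : IsIntegrallyClosed (MvPolynomial σ K) := UniqueFactorizationMonoid.instIsIntegrallyClosed
  suffices IsIntegrallyClosedIn (MvPolynomial σ R) (MvPolynomial σ K) from
    .of_isIntegrallyClosed_of_isIntegrallyClosedIn _ (MvPolynomial σ K)
  rw [isIntegrallyClosedIn_iff]
  refine ⟨MvPolynomial.map_injective _ (IsFractionRing.injective R K), fun {p} hp => ?_⟩
  rw [MvPolynomial.isIntegral_iff_isIntegral_coeff] at hp
  have : p ∈ Set.range (MvPolynomial.map (σ := σ) (algebraMap R K)) := by
    rw [MvPolynomial.mem_range_map_iff_coeffs_subset]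
    intro a ha
    obtain ⟨n, hn, rfl⟩ := MvPolynomial.mem_coeffs_iff.mp ha
    exact IsIntegrallyClosed.isIntegral_iff.mp (hp _)
  exact this

theorem qf_going_down {R S : Type*} [CommRing R] [CommRing S] [Algebra R S] [IsDomain R]
    [IsIntegrallyClosed R] [IsDomain S] [FaithfulSMul R S] [Algebra.FiniteType R S]
    (x : Ideal S) [x.IsPrime] [Algebra.QuasiFiniteAt R x] (w : Ideal R) [w.IsPrime]
    (hw : w ≤ x.under R) : ∃ p : Ideal S, p.IsPrime ∧ p ≤ x ∧ p.under R = w := by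
  obtain ⟨r, hrx, hri, hr⟩ := (Algebra.zariskisMainProperty_iff).mp
    (Algebra.ZariskisMainProperty.of_finiteType (R := R) x)
  have hlo : (x.under (integralClosure R S)).LiesOver (x.under R) :=
    ⟨by rw [Ideal.under_under]⟩
  have hFS : FaithfulSMul R (integralClosure R S) := inferInstance
  obtain ⟨P, hP, hPp, hPo⟩ : ∃ P : Ideal (integralClosure R S),
    P ≤ x.under (integralClosure R S) ∧ P.IsPrime ∧ P.LiesOver w :=
    Ideal.exists_ideal_le_liesOver_of_le (x.under (integralClosure R S)) hw
  have hrP : (⟨r, hri⟩ : integralClosure R S) ∉ P := fun h => hrx (hP h)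
  have key : ∀ s : integralClosure R S, ∀ n, (⟨r, hri⟩ : integralClosure R S)^n * s ∈ P → s ∈ P :=
    fun s n h => (hPp.mem_or_mem h).resolve_left fun h => hrP (hPp.mem_of_pow_mem _ h)
  let p : Ideal S :=
    { carrier := {s | ∃ n, ∃ d ∈ P, (d : S) = r ^ n * s}
      zero_mem' := ⟨0, 0, P.zero_mem, by simp⟩
      add_mem' := by
        rintro a b ⟨n, d, hd, h⟩ ⟨m, e, he, h'⟩
        refine ⟨n + m, ⟨r, hri⟩ ^ m * d + ⟨r, hri⟩ ^ n * e,
          P.add_mem (P.mul_mem_left _ hd) (P.mul_mem_left _ he), ?_⟩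
        push_cast
        rw [h, h']; ring
      smul_mem' := by
        rintro c a ⟨n, d, hd, h⟩
        obtain ⟨m, hm⟩ := hr c
        refine ⟨n + m, ⟨_, hm⟩ * d, P.mul_mem_left _ hd, ?_⟩
        push_cast
        rw [h, smul_eq_mul]; ring }
  have hmem : ∀ s (hs : IsIntegral R s), s ∈ p → (⟨s, hs⟩ : integralClosure R S) ∈ P := by
    rintro s hs ⟨n, d, hd, h⟩
    refine key _ n ?_
    convert hd using 1
    ext; simp [h]
  have hpx : p ≤ x := by
    rintro s ⟨n, d, hd, h⟩
    have : r ^ n * s ∈ x := h ▸ hP hd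
    exact ((‹x.IsPrime›).mem_or_mem this).resolve_left fun h => hrx (‹x.IsPrime›.mem_of_pow_mem _ h)
  refine ⟨p, ⟨fun h => ‹x.IsPrime›.ne_top (top_unique (h ▸ hpx)), ?_⟩, hpx, ?_⟩
  · intro a b hab
    obtain ⟨n, hn⟩ := hr a
    obtain ⟨m, hm⟩ := hr b
    have h1 : (r ^ n * a) * (r ^ m * b) ∈ p := by
      convert p.mul_mem_left (r ^ (n + m)) hab using 1; ring
    have h2 := hmem _ (hn.mul hm) h1
    have h3 : (⟨_, hn⟩ : integralClosure R S) * ⟨_, hm⟩ ∈ P := h2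
    exact (hPp.mem_or_mem h3).imp (fun h => ⟨n, _, h, rfl⟩) (fun h => ⟨m, _, h, rfl⟩)
  · rw [hPo.over]
    ext s
    constructor
    · intro h
      exact hmem _ (isIntegral_algebraMap (A := S) (x := s)) h
    · intro h
      exact ⟨0, _, h, by simp⟩

open Ideal

theorem qf_iff {R S : Type*} [CommRing R] [CommRing S] [Algebra R S] [Algebra.FiniteType R S]
    (x : Ideal S) [hx : x.IsPrime] : Algebra.QuasiFiniteAt R x ↔
    ∀ p : Ideal S, p.IsPrime → (p ≤ x ∨ x ≤ p) → p.under R = x.under R → p = x := by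
  let X : PrimeSpectrum S := ⟨x, hx⟩
  let m := X.comap (algebraMap R S)
  let e := PrimeSpectrum.preimageHomeomorphFiber R S m
  let e' := PrimeSpectrum.preimageOrderIsoFiber R S m
  have hee : ∀ y, e y = e' y := fun y => rfl
  have h0 : Algebra.QuasiFiniteAt R x ↔ _ := Algebra.quasiFiniteAt_iff_isOpen_singleton_fiber X
  have : IsNoetherianRing (m.asIdeal.Fiber S) :=
    Algebra.FiniteType.isNoetherianRing m.asIdeal.ResidueField _
  have : IsJacobsonRing (m.asIdeal.Fiber S) :=
    isJacobsonRing_of_finiteType (A := m.asIdeal.ResidueField)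
  rw [h0]
  have h1 : IsOpen ({e ⟨X, rfl⟩} : Set (PrimeSpectrum (m.asIdeal.Fiber S))) ↔
     IsOpen (X := .comap (algebraMap R S) ⁻¹' {X.comap (algebraMap R S)}) {⟨X, rfl⟩} := by
    rw [← Set.image_singleton, e.isOpen_image]
  rw [← h1, (PrimeSpectrum.isOpen_singleton_tfae_of_isNoetherian_of_isJacobsonRing _).out 0 2 rfl rfl,
    PrimeSpectrum.isClosed_singleton_iff_isMaximal, ← PrimeSpectrum.isMax_iff]
  constructor
  · rintro ⟨hmax, hgen⟩ p hp hle hu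
    let Y : PrimeSpectrum.comap (algebraMap R S) ⁻¹' {m} := ⟨⟨p, hp⟩, PrimeSpectrum.ext hu⟩
    have : e' Y = e' ⟨X, rfl⟩ := by
      rcases hle with hle | hle
      · exact hgen ((PrimeSpectrum.le_iff_specializes _ _).mp (e'.monotone (show Y ≤ ⟨X, rfl⟩ from hle))) rfl
      · exact le_antisymm (hmax (e'.monotone (show ⟨X, rfl⟩ ≤ Y from hle))) (e'.monotone (show ⟨X, rfl⟩ ≤ Y from hle))
    have := e'.injective this
    exact congr($(this).1.1)
  · intro H
    constructor
    · intro b hb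
      obtain ⟨Y, rfl⟩ := e'.surjective b
      rw [hee] at hb ⊢
      have hb' := e'.le_iff_le.mp hb
      have : Y = ⟨X, rfl⟩ := by
        ext1; ext1
        exact H Y.1.1 Y.1.2 (Or.inr hb') congr($(Y.2).1)
      rw [this]
    · intro a b hb ha
      rw [Set.mem_singleton_iff] at ha ⊢
      subst ha
      obtain ⟨Y, rfl⟩ := e'.surjective b
      rw [hee] at hb ⊢
      have hb' := e'.le_iff_le.mp ((PrimeSpectrum.le_iff_specializes _ _).mpr hb)
      have : Y = ⟨X, rfl⟩ := by
        ext1; ext1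
        exact H Y.1.1 Y.1.2 (Or.inl hb') congr($(Y.2).1)
      rw [this]

theorem qf_algebraic {R S : Type*} [CommRing R] [CommRing S] [Algebra R S]
    (x : Ideal S) [hx : x.IsPrime] [Algebra.QuasiFiniteAt R x] (s : S) :
    ∃ f : Polynomial R, (∃ i, f.coeff i ∉ x.under R) ∧ Polynomial.aeval s f ∈ x := by
  let := Localization.AtPrime.algebraOfLiesOver (x.under R) x
  have hfin : Module.Finite (x.under R).ResidueField x.ResidueField := inferInstance
  have halg : IsAlgebraic (x.under R).ResidueField (algebraMap S x.ResidueField s) :=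
    Algebra.IsAlgebraic.isAlgebraic _
  let : Algebra (R ⧸ x.under R) x.ResidueField :=
    ((algebraMap (x.under R).ResidueField x.ResidueField).comp
      (algebraMap (R ⧸ x.under R) (x.under R).ResidueField)).toAlgebra
  have : IsScalarTower (R ⧸ x.under R) (x.under R).ResidueField x.ResidueField :=
    .of_algebraMap_eq' rfl
  have hc : (algebraMap (R ⧸ x.under R) x.ResidueField).comp (Ideal.Quotient.mk _) =
      algebraMap R x.ResidueField := by
    rw [IsScalarTower.algebraMap_eq R (x.under R).ResidueField x.ResidueField]
    rfl
  rw [← IsFractionRing.isAlgebraic_iff (R ⧸ x.under R)] at halg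
  obtain ⟨f, hf0, hf⟩ := halg
  obtain ⟨f, rfl⟩ := Polynomial.map_surjective _ (Ideal.Quotient.mk_surjective) f
  refine ⟨f, ?_, ?_⟩
  · by_contra! h
    apply hf0
    ext i
    simpa [Ideal.Quotient.eq_zero_iff_mem] using h i
  · rw [← Ideal.algebraMap_residueField_eq_zero (I := x)]
    rw [← Polynomial.aeval_algebraMap_apply]
    rw [← hf]
    rw [Polynomial.aeval_def, Polynomial.aeval_def, Polynomial.eval₂_map, hc]

open Ideal

/-- domain version -/
theorem core_domain {B D : Type*} {ι : Type} [Finite ι] [CommRing B] [IsDomain B]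
    [IsIntegrallyClosed B] [CommRing D] [IsDomain D] [Algebra B D] [FaithfulSMul B D]
    [Algebra.FiniteType B D] [Algebra (MvPolynomial ι B) D]
    [IsScalarTower B (MvPolynomial ι B) D]
    (x : Ideal D) [x.IsPrime] [Algebra.QuasiFiniteAt (MvPolynomial ι B) x]
    (hcard : (Nat.card ι : Cardinal) ≤ Algebra.trdeg B D)
    (w : Ideal (MvPolynomial ι B)) [w.IsPrime] (hw : w ≤ x.under _) :
    ∃ p : Ideal D, p.IsPrime ∧ p ≤ x ∧ p.under (MvPolynomial ι B) = w := by
  have hbot : Algebra.QuasiFiniteAt (MvPolynomial ι B) (⊥ : Ideal D) :=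
    .of_le (bot_le : ⊥ ≤ x)
  let v : ι → D := fun i => algebraMap (MvPolynomial ι B) D (MvPolynomial.X i)
  have hv : IsScalarTower.toAlgHom B (MvPolynomial ι B) D = MvPolynomial.aeval v :=
    MvPolynomial.aeval_unique _
  have hv' : ∀ f, MvPolynomial.aeval v f = algebraMap (MvPolynomial ι B) D f := fun f => by
    rw [← hv]; rfl
  have halg : Algebra.IsAlgebraic (Algebra.adjoin B (Set.range v)) D := by
    constructor
    intro s
    obtain ⟨f, ⟨i, hi⟩, hf⟩ := qf_algebraic (R := MvPolynomial ι B) (⊥ : Ideal D) s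
    have hmem : ∀ g, algebraMap (MvPolynomial ι B) D g ∈ Algebra.adjoin B (Set.range v) := by
      intro g
      rw [Algebra.adjoin_range_eq_range_aeval, ← hv' g]
      exact ⟨g, rfl⟩
    let φ : MvPolynomial ι B →+* Algebra.adjoin B (Set.range v) :=
      (algebraMap (MvPolynomial ι B) D).codRestrict (Algebra.adjoin B (Set.range v)) hmem
    refine ⟨f.map φ, ?_, ?_⟩
    · intro h0
      apply hi
      have := congr((($h0).coeff i : D))
      rw [Polynomial.coeff_map] at this
      exact this
    · rw [Polynomial.aeval_def, Polynomial.eval₂_map]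
      exact hf
  have htb : IsTranscendenceBasis B v := by
    refine Algebra.IsAlgebraic.isTranscendenceBasis_of_lift_le_trdeg_of_finite B v ?_
    rw [← Nat.cast_card]; simpa using hcard
  have hinj : Function.Injective (algebraMap (MvPolynomial ι B) D) := by
    have : Function.Injective (MvPolynomial.aeval (R := B) v) := htb.1
    intro a b hab
    apply this
    rwa [hv', hv']
  have : FaithfulSMul (MvPolynomial ι B) D := (faithfulSMul_iff_algebraMap_injective _ _).mpr hinj
  have : IsIntegrallyClosed (MvPolynomial ι B) := isIntClosed_mvPoly
  have : Algebra.FiniteType (MvPolynomial ι B) D := .of_restrictScalars_finiteType B _ _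
  exact qf_going_down x w hw

theorem core_going_down {B C : Type*} {ι : Type} [Finite ι] [CommRing B] [IsDomain B]
    [IsIntegrallyClosed B] [CommRing C] [Algebra B C]
    [Algebra.FiniteType B C] [Algebra (MvPolynomial ι B) C]
    [IsScalarTower B (MvPolynomial ι B) C]
    (x : Ideal C) [x.IsPrime] [Algebra.QuasiFiniteAt (MvPolynomial ι B) x]
    (P : Ideal C) [P.IsPrime] (hPx : P ≤ x) (hP0 : P.under B = ⊥)
    (hcard : (Nat.card ι : Cardinal) ≤ Algebra.trdeg B (C ⧸ P))
    (w : Ideal (MvPolynomial ι B)) [w.IsPrime] (hw : w ≤ x.under _) :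
    ∃ p : Ideal C, p.IsPrime ∧ p ≤ x ∧ p.under (MvPolynomial ι B) = w := by
  have hker : RingHom.ker (Ideal.Quotient.mk P) ≤ x := by simpa using hPx
  have hx' : (x.map (Ideal.Quotient.mk P)).IsPrime :=
    Ideal.map_isPrime_of_surjective Ideal.Quotient.mk_surjective hker
  have hc : (x.map (Ideal.Quotient.mk P)).comap (Ideal.Quotient.mk P) = x := by
    rw [Ideal.comap_map_of_surjective' _ Ideal.Quotient.mk_surjective, sup_eq_left.mpr hker]
  have : FaithfulSMul B (C ⧸ P) := by
    rw [faithfulSMul_iff_algebraMap_injective, RingHom.injective_iff_ker_eq_bot, ← hP0]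
    ext b
    rw [RingHom.mem_ker, IsScalarTower.algebraMap_apply B C (C ⧸ P), Ideal.Quotient.algebraMap_eq,
      Ideal.Quotient.eq_zero_iff_mem]; rfl
  have : Algebra.QuasiFiniteAt (MvPolynomial ι B) (x.map (Ideal.Quotient.mk P)) :=
    .of_surjectiveOnStalks x (Ideal.Quotient.mkₐ _ P)
      (RingHom.surjectiveOnStalks_of_surjective Ideal.Quotient.mk_surjective) _ hc.symm
  obtain ⟨p, hp, hpx, hpw⟩ := core_domain (B := B) (x.map (Ideal.Quotient.mk P)) hcard w (by
    refine hw.trans (le_of_eq ?_)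
    conv_lhs => rw [← hc]
    rfl)
  refine ⟨p.comap (Ideal.Quotient.mk P), inferInstance, ?_, ?_⟩
  · rw [← hc]; exact Ideal.comap_mono hpx
  · rw [← hpw]; rfl


theorem exists_prime_tensor {B B' C : Type*} [CommRing B] [CommRing B'] [CommRing C]
    [Algebra B B'] [Algebra B C] (p : Ideal B') [hp : p.IsPrime] (x : Ideal C) [hx : x.IsPrime]
    (h : p.under B = x.under B) :
    ∃ P : Ideal (B' ⊗[B] C), P.IsPrime ∧
      P.comap (algebraMap B' (B' ⊗[B] C)) = p ∧
      P.comap (Algebra.TensorProduct.includeRight : C →ₐ[B] B' ⊗[B] C) = x := by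
  let q := x.under B
  have hq : q.IsPrime := inferInstance
  let k := q.ResidueField
  let : Algebra k p.ResidueField := (Ideal.ResidueField.mapₐ q p (Algebra.ofId B B') h.symm).toAlgebra
  let : Algebra k x.ResidueField := (Ideal.ResidueField.mapₐ q x (Algebra.ofId B C) rfl).toAlgebra
  have : IsScalarTower B k p.ResidueField := .of_algebraMap_eq' 
    (Ideal.ResidueField.mapₐ q p (Algebra.ofId B B') h.symm).comp_algebraMap.symm
  have : IsScalarTower B k x.ResidueField := .of_algebraMap_eq' 
    (Ideal.ResidueField.mapₐ q x (Algebra.ofId B C) rfl).comp_algebraMap.symm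
  let T := p.ResidueField ⊗[k] x.ResidueField
  obtain ⟨m, hm⟩ := Ideal.exists_maximal T
  have hmp := hm.isPrime
  let f : B' →ₐ[B] T := (IsScalarTower.toAlgHom B p.ResidueField T).comp
      (IsScalarTower.toAlgHom B B' p.ResidueField)
  let g : C →ₐ[B] T := ((Algebra.TensorProduct.includeRight : x.ResidueField →ₐ[k] T).restrictScalars B).comp
      (IsScalarTower.toAlgHom B C x.ResidueField)
  let F : B' ⊗[B] C →ₐ[B] T := Algebra.TensorProduct.lift f g fun _ _ => .all _ _
  refine ⟨m.comap F, inferInstance, ?_, ?_⟩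
  · have h1 : m.comap (algebraMap p.ResidueField T) = ⊥ :=
      (Ideal.eq_bot_or_top _).resolve_right (Ideal.IsPrime.ne_top inferInstance)
    ext b
    have : F (algebraMap B' (B' ⊗[B] C) b) = algebraMap p.ResidueField T (algebraMap B' _ b) := by
      simp [F, f]
    rw [Ideal.mem_comap, Ideal.mem_comap, this, ← Ideal.mem_comap, h1, Ideal.mem_bot,
      Ideal.algebraMap_residueField_eq_zero]
  · have h1 : m.comap (Algebra.TensorProduct.includeRight : x.ResidueField →ₐ[k] T) = ⊥ :=
      (Ideal.eq_bot_or_top _).resolve_right (Ideal.IsPrime.ne_top inferInstance)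
    ext b
    have : F ((Algebra.TensorProduct.includeRight : C →ₐ[B] B' ⊗[B] C) b) =
      (Algebra.TensorProduct.includeRight : x.ResidueField →ₐ[k] T) (algebraMap C _ b) := by
      simp [F, g]
    rw [Ideal.mem_comap, Ideal.mem_comap, this, ← Ideal.mem_comap, h1, Ideal.mem_bot,
      Ideal.algebraMap_residueField_eq_zero]


theorem under_bot_of_minimal {B C : Type*} [CommRing B] [CommRing C] [Algebra B C]
    (ht : ∀ b : B, b ≠ 0 → ∀ c : C, algebraMap B C b * c = 0 → c = 0)
    {P : Ideal C} (hP : P ∈ minimalPrimes C) : P.under B = ⊥ := by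
  rw [eq_bot_iff]
  intro b hb
  by_contra hb0
  refine Set.disjoint_left.mp (Ideal.disjoint_nonZeroDivisors_of_mem_minimalPrimes hP) hb ?_
  rw [SetLike.mem_coe, mem_nonZeroDivisors_iff_right]
  intro z hz
  exact ht b hb0 z (by rw [mul_comm]; exact hz)

theorem minimal_under {B C C' : Type*} [CommRing B] [IsDomain B] [CommRing C] [CommRing C']
    [Algebra B C] [Algebra B C'] [Algebra C C'] [IsScalarTower B C C']
    (hinj : Function.Injective (algebraMap C C'))
    (ht : ∀ b : B, b ≠ 0 → ∀ c : C', algebraMap B C' b * c = 0 → c = 0)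
    (hden : ∀ c' : C', ∃ b : B, b ≠ 0 ∧ ∃ c : C, algebraMap B C' b * c' = algebraMap C C' c)
    {P : Ideal C'} (hP : P ∈ minimalPrimes C') : P.under C ∈ minimalPrimes C := by
  have hPp : P.IsPrime := hP.1.1
  have htC : ∀ b : B, b ≠ 0 → ∀ c : C, algebraMap B C b * c = 0 → c = 0 := by
    intro b hb c hc
    apply hinj
    rw [map_zero]
    refine ht b hb _ ?_
    rw [IsScalarTower.algebraMap_apply B C C', ← map_mul, hc, map_zero]
  obtain ⟨Q, hQ, hQle⟩ := Ideal.exists_minimalPrimes_le (I := ⊥) (J := P.under C) bot_le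
  have hQp : Q.IsPrime := hQ.1.1
  have hPB := under_bot_of_minimal ht hP
  have hQB := under_bot_of_minimal htC hQ
  have hbQ : ∀ b : B, b ≠ 0 → algebraMap B C b ∉ Q := fun b hb h => hb (by
    have : b ∈ Q.under B := h
    rwa [hQB] at this)
  have hbP : ∀ b : B, b ≠ 0 → algebraMap B C' b ∉ P := fun b hb h => hb (by
    have : b ∈ P.under B := h
    rwa [hPB] at this)
  let P' : Ideal C' :=
    { carrier := {c' | ∃ b : B, b ≠ 0 ∧ ∃ c ∈ Q, algebraMap B C' b * c' = algebraMap C C' c}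
      zero_mem' := ⟨1, one_ne_zero, 0, Q.zero_mem, by simp⟩
      add_mem' := by
        rintro a a' ⟨b, hb, c, hc, h⟩ ⟨b', hb', c', hc', h'⟩
        refine ⟨b * b', mul_ne_zero hb hb', algebraMap B C b' * c + algebraMap B C b * c',
          Q.add_mem (Q.mul_mem_left _ hc) (Q.mul_mem_left _ hc'), ?_⟩
        simp only [map_mul, map_add, ← IsScalarTower.algebraMap_apply, ← h, ← h']
        ring
      smul_mem' := by
        rintro r a ⟨b, hb, c, hc, h⟩
        obtain ⟨b', hb', c', h'⟩ := hden r
        refine ⟨b * b', mul_ne_zero hb hb', c' * c, Q.mul_mem_left _ hc, ?_⟩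
        simp only [map_mul, ← h, ← h', smul_eq_mul]
        ring }
  have hP'P : P' ≤ P := by
    rintro a ⟨b, hb, c, hc, h⟩
    have : algebraMap B C' b * a ∈ P := by rw [h]; exact hQle hc
    exact (hPp.mem_or_mem this).resolve_left (hbP b hb)
  have hP'p : P'.IsPrime := by
    refine ⟨fun h => hPp.ne_top (top_unique (h ▸ hP'P)), ?_⟩
    rintro a a' ⟨b, hb, c, hc, h⟩
    obtain ⟨b1, hb1, c1, h1⟩ := hden a
    obtain ⟨b2, hb2, c2, h2⟩ := hden a'
    have : algebraMap B C b * (c1 * c2) = algebraMap B C (b1 * b2) * c := by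
      apply hinj
      simp only [map_mul, ← h1, ← h2, ← h, ← IsScalarTower.algebraMap_apply]
      ring
    have : algebraMap B C b * (c1 * c2) ∈ Q := this ▸ Q.mul_mem_left _ hc
    have := (hQp.mem_or_mem this).resolve_left (hbQ b hb)
    exact (hQp.mem_or_mem this).imp (fun h => ⟨b1, hb1, c1, h, h1⟩) (fun h => ⟨b2, hb2, c2, h, h2⟩)
  have hPP' : P ≤ P' := hP.2 ⟨hP'p, bot_le⟩ hP'P
  have : P.under C = Q := by
    refine le_antisymm ?_ hQle
    intro c hc
    obtain ⟨b, hb, c0, hc0, h⟩ := hPP' hc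
    have h3 : algebraMap B C b * c = c0 := by
      apply hinj
      rw [map_mul, ← IsScalarTower.algebraMap_apply, h]
    exact (hQp.mem_or_mem (h3 ▸ hc0)).resolve_left (hbQ b hb)
  rwa [this]

theorem incomparable {C C' : Type*} [CommRing C] [CommRing C'] [Algebra C C']
    [Algebra.IsIntegral C C'] {I J : Ideal C'} [I.IsPrime] (h : I ≤ J)
    (hu : I.under C = J.under C) : I = J := by
  by_contra hne
  exact (Ideal.IsIntegral.comap_lt_comap (R := C) (lt_of_le_of_ne h hne)).ne hu

theorem L7a {B B' C C' : Type u} {ι : Type} [Finite ι] [CommRing B] [IsDomain B]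
    [CommRing B'] [IsDomain B'] [IsIntegrallyClosed B'] [CommRing C] [CommRing C']
    [Algebra B B'] [Algebra B C] [Algebra B C'] [Algebra C C'] [Algebra B' C']
    [IsScalarTower B C C'] [IsScalarTower B B' C'] [Algebra.IsIntegral B B'] [FaithfulSMul B B']
    [Algebra.FiniteType B' C'] [Algebra.IsIntegral C C']
    (hinj : Function.Injective (algebraMap C C'))
    (ht : ∀ b : B, b ≠ 0 → ∀ c : C', algebraMap B C' b * c = 0 → c = 0)
    (hden : ∀ c' : C', ∃ b : B, b ≠ 0 ∧ ∃ c : C, algebraMap B C' b * c' = algebraMap C C' c)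
    (x' : Ideal C') [x'.IsPrime] (x : Ideal C) (hxx : x'.under C = x)
    (v : ι → C) (S : Set ι) (hS : ∀ i ∈ S, v i ∈ x)
    (h1 : ∀ p : Ideal C, p.IsPrime → (p ≤ x ∨ x ≤ p) →
      (∀ f : MvPolynomial ι B, MvPolynomial.aeval v f ∈ p ↔ MvPolynomial.aeval v f ∈ x) → p = x)
    (h2 : ∀ P ∈ minimalPrimes C, P ≤ x → (Nat.card ι : Cardinal) ≤ Algebra.trdeg B (C ⧸ P))
    (q₁ : Ideal B') [hq₁ : q₁.IsPrime] (hq₁x : q₁ ≤ x'.under B') :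
    ∃ p : Ideal C, p.IsPrime ∧ p ≤ x ∧ p.under B = q₁.under B ∧ (∀ i ∈ S, v i ∈ p) ∧
      (S = Set.univ → ∀ y : Ideal C, y.IsPrime → p ≤ y → y.under B = q₁.under B → y = p) := by
  classical
  obtain ⟨P, hP, hPx⟩ := Ideal.exists_minimalPrimes_le (I := ⊥) (J := x') bot_le
  have hPp : P.IsPrime := hP.1.1
  have hPm := minimal_under hinj ht hden hP
  have hPB : P.under B' = ⊥ := by
    have := under_bot_of_minimal ht hP
    rw [← Ideal.under_under (B := B')] at this
    exact Ideal.eq_bot_of_comap_eq_bot (R := B) this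
  have hFS : FaithfulSMul B' (C' ⧸ P) := by
    rw [faithfulSMul_iff_algebraMap_injective, RingHom.injective_iff_ker_eq_bot, ← hPB]
    ext b
    rw [RingHom.mem_ker, IsScalarTower.algebraMap_apply B' C' (C' ⧸ P), Ideal.Quotient.algebraMap_eq,
      Ideal.Quotient.eq_zero_iff_mem]; rfl
  have hcard : (Nat.card ι : Cardinal) ≤ Algebra.trdeg B' (C' ⧸ P) := by
    refine (h2 _ hPm (hxx ▸ Ideal.comap_mono hPx)).trans ?_
    let g : C ⧸ P.under C →ₐ[B] C' ⧸ P := Ideal.quotientMapₐ P (IsScalarTower.toAlgHom B C C') le_rfl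
    have hg : Function.Injective g := Ideal.quotientMap_injective
    have h3 := trdeg_le_of_injective g hg
    refine h3.trans ?_
    have := trdeg_add_eq B B' (A := C' ⧸ P)
    rw [← this, trdeg_eq_zero, zero_add]
  let v' : ι → C' := fun i => algebraMap C C' (v i)
  let : Algebra (MvPolynomial ι B') C' := (MvPolynomial.aeval v').toAlgebra
  have hal : ∀ f, algebraMap (MvPolynomial ι B') C' f = MvPolynomial.aeval v' f := fun f => rfl
  have : IsScalarTower B' (MvPolynomial ι B') C' :=
    .of_algebraMap_eq' (MvPolynomial.aeval v').comp_algebraMap.symm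
  have : Algebra.FiniteType (MvPolynomial ι B') C' := .of_restrictScalars_finiteType B' _ _
  have hmap : ∀ f : MvPolynomial ι B, algebraMap C C' (MvPolynomial.aeval v f) =
      algebraMap (MvPolynomial ι B') C' (MvPolynomial.map (algebraMap B B') f) := by
    intro f
    rw [hal, MvPolynomial.aeval_map_algebraMap]
    exact (MvPolynomial.aeval_algebraMap_apply C' v f).symm
  have hqf : Algebra.QuasiFiniteAt (MvPolynomial ι B') x' := by
    rw [qf_iff]
    intro p hp hcomp hu
    have hpx : p.under C = x := by
      refine h1 _ inferInstance ?_ ?_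
      · rw [← hxx]
        exact hcomp.imp (fun h => Ideal.comap_mono h) (fun h => Ideal.comap_mono h)
      · intro f
        rw [← hxx]
        change algebraMap C C' _ ∈ p ↔ algebraMap C C' _ ∈ x'
        rw [hmap]
        change _ ∈ p.under (MvPolynomial ι B') ↔ _ ∈ x'.under (MvPolynomial ι B')
        rw [hu]
    rcases hcomp with h | h
    · exact incomparable h (hpx.trans hxx.symm)
    · exact (incomparable h (hxx.trans hpx.symm)).symm
  let φ : MvPolynomial ι B' →+* MvPolynomial ι (B' ⧸ q₁) :=
    MvPolynomial.eval₂Hom (MvPolynomial.C.comp (Ideal.Quotient.mk q₁))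
      (fun i => if i ∈ S then 0 else MvPolynomial.X i)
  let w := RingHom.ker φ
  have hwp : w.IsPrime := RingHom.ker_isPrime _
  have hwX : ∀ i ∈ S, MvPolynomial.X i ∈ w := by
    intro i hi
    simp [w, φ, RingHom.mem_ker, hi]
  have hwC : ∀ b, MvPolynomial.C b ∈ w ↔ b ∈ q₁ := by
    intro b
    simp [w, φ, RingHom.mem_ker, Ideal.Quotient.eq_zero_iff_mem]
  have hwx : w ≤ x'.under (MvPolynomial ι B') := by
    let ψ : MvPolynomial ι (B' ⧸ q₁) →+* C' ⧸ x' := MvPolynomial.eval₂Hom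
      (Ideal.quotientMap x' (algebraMap B' C') hq₁x) (fun i => Ideal.Quotient.mk x' (v' i))
    have : ψ.comp φ = (Ideal.Quotient.mk x').comp (algebraMap (MvPolynomial ι B') C') := by
      refine MvPolynomial.ringHom_ext ?_ ?_
      · intro b
        change ψ (φ _) = Ideal.Quotient.mk x' (algebraMap (MvPolynomial ι B') C' _)
        rw [hal]
        simp [ψ, φ, -Ideal.Quotient.mk_algebraMap]
      · intro i
        change ψ (φ _) = Ideal.Quotient.mk x' (algebraMap (MvPolynomial ι B') C' _)
        rw [hal]
        by_cases hi : i ∈ S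
        · have : algebraMap C C' (v i) ∈ x' := by
            have := hS i hi
            rwa [← hxx] at this
          have := (Ideal.Quotient.eq_zero_iff_mem.mpr this).symm
          simpa [ψ, φ, hal, hi, v', -Ideal.Quotient.mk_algebraMap] using this
        · simp [ψ, φ, hal, hi, -Ideal.Quotient.mk_algebraMap]
    intro f hf
    have h3 := congr($this f)
    rw [RingHom.comp_apply, (RingHom.mem_ker).mp hf, map_zero] at h3
    exact (Ideal.Quotient.eq_zero_iff_mem (I := x')).mp h3.symm
  obtain ⟨p, hp, hpx, hpw⟩ := core_going_down (B := B') x' P hPx hPB hcard w hwx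
  have hpq : p.under B' = q₁ := by
    ext b
    rw [← hwC, ← hpw]
    change _ ↔ algebraMap (MvPolynomial ι B') C' (MvPolynomial.C b) ∈ p
    rw [hal, MvPolynomial.aeval_C]
    rfl
  refine ⟨p.under C, inferInstance, hxx ▸ Ideal.comap_mono hpx, ?_, ?_, ?_⟩
  · rw [Ideal.under_under, ← hpq, Ideal.under_under]
  · intro i hi
    have := hwX i hi
    rw [← hpw] at this
    have h4 : algebraMap (MvPolynomial ι B') C' (MvPolynomial.X i) ∈ p := this
    rwa [hal, MvPolynomial.aeval_X] at h4
  · intro hSu y hy hpy hyq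
    obtain ⟨Q, hQp, hQ, hQy⟩ := Ideal.exists_ideal_over_prime_of_isIntegral y p hpy
    have hqfp : Algebra.QuasiFiniteAt (MvPolynomial ι B') p := .of_le hpx
    have hQq : Q.under B' = q₁ := by
      symm
      have h5 : q₁ ≤ Q.under B' := by rw [← hpq]; exact Ideal.comap_mono hQp
      refine incomparable (C := B) h5 ?_
      rw [Ideal.under_under, ← hyq, ← hQy]
      exact Ideal.under_under (A := B) (B := C) Q
    have : Q = p := by
      refine (qf_iff (R := MvPolynomial ι B') p).mp hqfp Q hQ (Or.inr hQp) ?_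
      refine le_antisymm ?_ (Ideal.comap_mono hQp)
      intro f hf
      have hall : ∀ f, f - MvPolynomial.C (MvPolynomial.constantCoeff f) ∈ w := by
        intro f
        rw [RingHom.mem_ker, map_sub, sub_eq_zero]
        have : φ = (φ.comp MvPolynomial.C).comp MvPolynomial.constantCoeff := by
          refine MvPolynomial.ringHom_ext ?_ ?_
          · intro b; simp
          · intro i; simp [φ, hSu]
        exact congr($this f)
      have h6 := hall f
      have h7 : MvPolynomial.C (MvPolynomial.constantCoeff f) ∈ w := by
        rw [hwC, ← hQq]
        change algebraMap B' C' _ ∈ Q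
        rw [IsScalarTower.algebraMap_apply B' (MvPolynomial ι B') C']
        have h8 : f - MvPolynomial.C (MvPolynomial.constantCoeff f) ∈ Q.under (MvPolynomial ι B') :=
          Ideal.comap_mono hQp (hpw.symm.le h6)
        have := Ideal.sub_mem _ hf h8
        rwa [sub_sub_cancel] at this
      rw [hpw]
      have := Ideal.add_mem _ h6 h7
      rwa [sub_add_cancel] at this
    rw [← hQy, this]


attribute [local instance] Algebra.TensorProduct.rightAlgebra in
theorem isIntegral_right {B B' C : Type*} [CommRing B] [CommRing B'] [CommRing C] [Algebra B B']
    [Algebra B C] [Algebra.IsIntegral B B'] : Algebra.IsIntegral C (B' ⊗[B] C) :=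
  Algebra.IsIntegral.of_surjective (Algebra.TensorProduct.commRight B C B').toAlgHom
    (Algebra.TensorProduct.commRight B C B').surjective

attribute [local instance] Algebra.TensorProduct.rightAlgebra in
theorem L7b0 {B B' C : Type u} {ι : Type} [Finite ι] [CommRing B] [IsDomain B]
    [CommRing B'] [IsDomain B'] [IsIntegrallyClosed B'] [Algebra B B'] [Algebra.IsIntegral B B']
    [FaithfulSMul B B'] (hd : ∀ b : B', ∃ s : B, s ≠ 0 ∧ ∃ a, algebraMap B B' s * b = algebraMap B B' a)
    [CommRing C] [Algebra B C] [Module.Flat B C] [Algebra.FiniteType B C]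
    (x : Ideal C) [x.IsPrime]
    (v : ι → C) (S : Set ι) (hS : ∀ i ∈ S, v i ∈ x)
    (h1 : ∀ p : Ideal C, p.IsPrime → (p ≤ x ∨ x ≤ p) →
      (∀ f : MvPolynomial ι B, MvPolynomial.aeval v f ∈ p ↔ MvPolynomial.aeval v f ∈ x) → p = x)
    (h2 : ∀ P ∈ minimalPrimes C, P ≤ x → (Nat.card ι : Cardinal) ≤ Algebra.trdeg B (C ⧸ P))
    (q' : Ideal B) [hq' : q'.IsPrime] (hq'x : q' ≤ x.under B) :
    ∃ p : Ideal C, p.IsPrime ∧ p ≤ x ∧ p.under B = q' ∧ (∀ i ∈ S, v i ∈ p) ∧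
      (S = Set.univ → ∀ y : Ideal C, y.IsPrime → p ≤ y → y.under B = q' → y = p) := by
  have hBB' : Function.Injective (algebraMap B B') := FaithfulSMul.algebraMap_injective B B'
  obtain ⟨q₁, -, hq₁, hq₁q⟩ := Ideal.exists_ideal_over_prime_of_isIntegral (S := B') q' ⊥ (by
    intro b hb
    have : algebraMap B B' b = 0 := hb
    rw [(map_eq_zero_iff _ hBB').mp this]; exact q'.zero_mem)
  obtain ⟨q₂, hq₁₂, hq₂, hq₂x⟩ := Ideal.exists_ideal_over_prime_of_isIntegral (S := B') (x.under B) q₁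
    (by rw [hq₁q]; exact hq'x)
  obtain ⟨x', hx', hx'q, hx'x⟩ := exists_prime_tensor q₂ x hq₂x
  let C' := B' ⊗[B] C
  have hal : ∀ c : C, algebraMap C C' c = 1 ⊗ₜ c := fun c => rfl
  have halB : ∀ b : B, algebraMap B C' b = algebraMap B' C' (algebraMap B B' b) := fun b =>
    IsScalarTower.algebraMap_apply B B' C' b
  have hintegral : Algebra.IsIntegral C C' := isIntegral_right
  have := L7a (B := B) (B' := B') (C := C) (C' := C')
    (Algebra.TensorProduct.includeRight_injective hBB')
    (by
      intro b hb c hc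
      have hb' : algebraMap B B' b ≠ 0 := fun h => hb ((map_eq_zero_iff _ hBB').mp h)
      rw [halB, ← Algebra.smul_def] at hc
      exact (smul_eq_zero.mp hc).resolve_left hb')
    (by
      intro c'
      induction c' using TensorProduct.induction_on with
      | zero => exact ⟨1, one_ne_zero, 0, by simp⟩
      | add a b ha hb =>
        obtain ⟨b1, hb1, c1, h1⟩ := ha
        obtain ⟨b2, hb2, c2, h2⟩ := hb
        refine ⟨b1 * b2, mul_ne_zero hb1 hb2,
          algebraMap B C b2 * c1 + algebraMap B C b1 * c2, ?_⟩
        simp only [map_mul, map_add, ← IsScalarTower.algebraMap_apply B C C', ← h1, ← h2]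
        ring
      | tmul b c =>
        obtain ⟨s, hs, a, h2⟩ := hd b
        refine ⟨s, hs, a • c, ?_⟩
        rw [hal, halB, ← smul_tmul, Algebra.TensorProduct.algebraMap_apply,
          Algebra.TensorProduct.tmul_mul_tmul, one_mul, Algebra.smul_def, mul_one]
        exact congr($h2 ⊗ₜ c))
    x' x hx'x v S hS h1 h2 q₁ (hq₁₂.trans hx'q.symm.le)
  rwa [show q₁.under B = q' from hq₁q] at this

theorem L7b {B C : Type u} {ι : Type} [Finite ι] [CommRing B] [IsDomain B]
    [CommRing C] [Algebra B C] [Module.Flat B C] [Algebra.FiniteType B C]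
    (x : Ideal C) [x.IsPrime]
    (v : ι → C) (S : Set ι) (hS : ∀ i ∈ S, v i ∈ x)
    (h1 : ∀ p : Ideal C, p.IsPrime → (p ≤ x ∨ x ≤ p) →
      (∀ f : MvPolynomial ι B, MvPolynomial.aeval v f ∈ p ↔ MvPolynomial.aeval v f ∈ x) → p = x)
    (h2 : ∀ P ∈ minimalPrimes C, P ≤ x → (Nat.card ι : Cardinal) ≤ Algebra.trdeg B (C ⧸ P))
    (q' : Ideal B) [hq' : q'.IsPrime] (hq'x : q' ≤ x.under B) :
    ∃ p : Ideal C, p.IsPrime ∧ p ≤ x ∧ p.under B = q' ∧ (∀ i ∈ S, v i ∈ p) ∧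
      (S = Set.univ → ∀ y : Ideal C, y.IsPrime → p ≤ y → y.under B = q' → y = p) := by
  let K := FractionRing B
  have : IsIntegrallyClosed (integralClosure B K) := integralClosure.isIntegrallyClosedOfFiniteExtension K
  refine L7b0 (B' := integralClosure B K) ?_ x v S hS h1 h2 q' hq'x
  intro b
  obtain ⟨a, s, h⟩ := IsLocalization.exists_mk'_eq (nonZeroDivisors B) (b : K)
  refine ⟨s, nonZeroDivisors.coe_ne_zero s, a, ?_⟩
  apply Subtype.ext
  change algebraMap B K s * (b : K) = algebraMap B K a
  rw [← h]; exact IsLocalization.mk'_spec' K a s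


theorem height_under_le {R S : Type*} [CommRing R] [CommRing S] [Algebra R S]
    [Algebra.HasGoingDown R S] (P : Ideal S) [hP : P.IsPrime] : (P.under R).height ≤ P.height := by
  have h1 := PrimeSpectrum.height_eq_orderHeight (⟨P, hP⟩ : PrimeSpectrum S)
  have h2 := PrimeSpectrum.height_eq_orderHeight (⟨P.under R, inferInstance⟩ : PrimeSpectrum R)
  simp only at h1 h2
  rw [h1, h2, Order.height_le_iff']
  intro l hl
  have : P.LiesOver l.last.asIdeal := ⟨by rw [hl]⟩
  obtain ⟨L, hL, hLl, -⟩ := Ideal.exists_ltSeries_of_hasGoingDown l P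
  rw [← hL, ← hLl]
  exact Order.length_le_height_last

theorem trdeg_quot_comap {B R S : Type u} [CommRing B] [CommRing R] [CommRing S] [Algebra B R]
    [Algebra B S] (f : R →ₐ[B] S) (P : Ideal S) :
    Algebra.trdeg B (R ⧸ P.comap f) ≤ Algebra.trdeg B (S ⧸ P) := by
  let g : R ⧸ P.comap f →ₐ[B] S ⧸ P := Ideal.quotientMapₐ P f le_rfl
  have hg : Function.Injective g := Ideal.quotientMap_injective
  exact trdeg_le_of_injective g hg

theorem trdeg_quot_le {B R S : Type u} [CommRing B] [CommRing R] [CommRing S] [Algebra B R]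
    [Algebra B S] [Algebra R S] [IsScalarTower B R S] (P : Ideal S) :
    Algebra.trdeg B (R ⧸ P.under R) ≤ Algebra.trdeg B (S ⧸ P) := by
  let g : R ⧸ P.under R →ₐ[B] S ⧸ P := Ideal.quotientMapₐ P (IsScalarTower.toAlgHom B R S) le_rfl
  have hg : Function.Injective g := Ideal.quotientMap_injective
  exact trdeg_le_of_injective g hg

theorem faithful_quot {B R : Type*} [CommRing B] [CommRing R] [Algebra B R] (P : Ideal R)
    (h : P.under B = ⊥) : FaithfulSMul B (R ⧸ P) := by
  rw [faithfulSMul_iff_algebraMap_injective, RingHom.injective_iff_ker_eq_bot, ← h]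
  ext b
  rw [RingHom.mem_ker, IsScalarTower.algebraMap_apply B R (R ⧸ P), Ideal.Quotient.algebraMap_eq,
      Ideal.Quotient.eq_zero_iff_mem]; rfl

theorem poly_step {B R : Type u} [CommRing B] [IsDomain B] [CommRing R] [Algebra B R]
    (d : ℕ) (hR : ∀ n : Ideal R, n.IsPrime → n.under B = ⊥ → ∀ j : ℕ, n.height ≤ j →
      (d : Cardinal) ≤ Algebra.trdeg B (R ⧸ n) + j)
    (n : Ideal (Polynomial R)) [hn : n.IsPrime] (hnB : n.under B = ⊥) (j : ℕ) (hj : n.height ≤ j) :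
      ((d + 1 : ℕ) : Cardinal) ≤ Algebra.trdeg B (Polynomial R ⧸ n) + j := by
  set n0 := n.under R with hn0
  have hn0B : n0.under B = ⊥ := by rw [hn0, Ideal.under_under, hnB]
  have hmap : n0.map Polynomial.C ≤ n := Ideal.map_le_iff_le_comap.mpr le_rfl
  have hmp : (n0.map Polynomial.C).IsPrime := Ideal.isPrime_map_C_of_isPrime
  have hmu : (n0.map Polynomial.C).under R = n0 := by
    refine le_antisymm (Ideal.comap_mono hmap) ?_
    exact Ideal.le_comap_map
  have hhm : n0.height ≤ (n0.map Polynomial.C).height := by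
    conv_lhs => rw [← hmu]
    exact height_under_le (R := R) (n0.map Polynomial.C)
  rcases eq_or_lt_of_le hmap with heq | hlt
  · have h1 := hR n0 inferInstance hn0B j (hhm.trans (heq ▸ hj))
    let f : Polynomial R →ₐ[B] Polynomial (R ⧸ n0) := Polynomial.mapAlgHom (Ideal.Quotient.mkₐ B n0)
    have hf : Function.Surjective f := Polynomial.map_surjective _ Ideal.Quotient.mk_surjective
    have hker : RingHom.ker f = n := by
      rw [← heq]
      have := Polynomial.ker_mapRingHom (Ideal.Quotient.mk n0)
      rw [Ideal.mk_ker] at this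
      exact this
    have h2 : Algebra.trdeg B (Polynomial (R ⧸ n0)) ≤ Algebra.trdeg B (Polynomial R ⧸ n) := by
      rw [← hker]
      exact trdeg_le_of_injective (Ideal.quotientKerAlgEquivOfSurjective hf).symm.toAlgHom
        (Ideal.quotientKerAlgEquivOfSurjective hf).symm.injective
    have := faithful_quot n0 hn0B
    have h3 := trdeg_add_eq B (R ⧸ n0) (A := Polynomial (R ⧸ n0))
    rw [Polynomial.trdeg_of_isDomain] at h3
    push_cast
    calc (d : Cardinal) + 1 ≤ Algebra.trdeg B (R ⧸ n0) + j + 1 := by gcongr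
      _ = (Algebra.trdeg B (R ⧸ n0) + 1) + j := by ring
      _ ≤ _ := by rw [h3]; gcongr
  · have h1 := Ideal.height_add_one_le_of_lt_of_isPrime hlt
    have h2 : n0.height + 1 ≤ j := (add_le_add_left hhm 1).trans (h1.trans hj)
    obtain ⟨i, rfl⟩ : ∃ i, j = i + 1 := by
      rcases j with _ | i
      · simp at h2
      · exact ⟨i, rfl⟩
    have h3 : n0.height ≤ i := by
      push_cast at h2
      exact (ENat.add_le_add_iff_right ENat.one_ne_top).mp h2
    have h4 := hR n0 inferInstance hn0B i h3
    push_cast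
    calc (d : Cardinal) + 1 ≤ Algebra.trdeg B (R ⧸ n0) + i + 1 := by gcongr
      _ ≤ Algebra.trdeg B (Polynomial R ⧸ n) + i + 1 := by gcongr; exact trdeg_quot_le n
      _ = _ := by ring

theorem poly_dim {B : Type u} [CommRing B] [IsDomain B] (d : ℕ)  :
    ∀ n : Ideal (MvPolynomial (Fin d) B), n.IsPrime → n.under B = ⊥ → ∀ j : ℕ, n.height ≤ j →
      (d : Cardinal) ≤ Algebra.trdeg B (MvPolynomial (Fin d) B ⧸ n) + j := by
  induction d with
  | zero => intros; simp
  | succ d ih =>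
    intro n hn hnB j hj
    let e := MvPolynomial.finSuccEquiv B d
    have hp : (n.comap e.symm).IsPrime := Ideal.comap_isPrime _ _
    have := poly_step d ih (n.comap e.symm) (by
      rw [← hnB]; ext b
      change e.symm (algebraMap B _ b) ∈ n ↔ _
      rw [AlgEquiv.commutes]; rfl) j
      ((RingEquiv.height_comap e.symm.toRingEquiv n).le.trans hj)
    refine this.trans ?_
    gcongr
    exact trdeg_quot_comap e.symm.toAlgHom n

theorem L10 {B A : Type u} [CommRing B] [IsDomain B] [CommRing A] [Algebra B A] (d : ℕ)
    [Algebra (MvPolynomial (Fin d) B) A] [IsScalarTower B (MvPolynomial (Fin d) B) A]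
    [Module.Flat (MvPolynomial (Fin d) B) A] (Q : Ideal A) [Q.IsPrime] (hQ : Q.under B = ⊥) (j : ℕ)
    (hj : Q.height ≤ j) : (d : Cardinal) ≤ Algebra.trdeg B (A ⧸ Q) + j := by
  refine (poly_dim d (Q.under (MvPolynomial (Fin d) B)) inferInstance ?_ j
    ((height_under_le Q).trans hj)).trans ?_
  · rw [Ideal.under_under, hQ]
  · gcongr; exact trdeg_quot_le Q


theorem minimal_under_goingDown {R S : Type*} [CommRing R] [CommRing S] [Algebra R S]
    [Algebra.HasGoingDown R S] {P : Ideal S} (hP : P ∈ minimalPrimes S) :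
    P.under R ∈ minimalPrimes R := by
  have hPp : P.IsPrime := hP.1.1
  refine ⟨⟨inferInstance, bot_le⟩, ?_⟩
  rintro Q ⟨hQ, -⟩ hQP
  obtain ⟨P', hP'le, hP', hlo⟩ := Ideal.exists_ideal_le_liesOver_of_le (p := Q) (q := P.under R) P hQP
  have : P = P' := le_antisymm (hP.2 ⟨hP', bot_le⟩ hP'le) hP'le
  rw [this, hlo.over]

theorem minimal_includeLeft {B R1 R2 : Type*} [CommRing B] [CommRing R1] [CommRing R2] [Algebra B R1]
    [Algebra B R2] [Module.Flat B R2] {P : Ideal (R1 ⊗[B] R2)} (hP : P ∈ minimalPrimes (R1 ⊗[B] R2)) :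
    P.under R1 ∈ minimalPrimes R1 := minimal_under_goingDown hP

attribute [local instance] Algebra.TensorProduct.rightAlgebra in
theorem minimal_includeRight {B R1 R2 : Type*} [CommRing B] [CommRing R1] [CommRing R2] [Algebra B R1]
    [Algebra B R2] [Module.Flat B R1] {P : Ideal (R1 ⊗[B] R2)} (hP : P ∈ minimalPrimes (R1 ⊗[B] R2)) :
    P.comap (Algebra.TensorProduct.includeRight : R2 →ₐ[B] R1 ⊗[B] R2) ∈ minimalPrimes R2 := by
  have : Module.Flat R2 (R1 ⊗[B] R2) :=
    .of_linearEquiv (Algebra.TensorProduct.commRight B R2 R1).symm.toLinearEquiv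
  exact minimal_under_goingDown (R := R2) hP

theorem flat_of_units {W N : Type*} [CommRing W] [IsDomain W] [CommRing N] [Algebra W N]
    (h : ∀ w : W, w ≠ 0 → IsUnit (algebraMap W N w)) : Module.Flat W N := by
  let K := FractionRing W
  let g : K →+* N := IsLocalization.lift (M := nonZeroDivisors W) (g := algebraMap W N)
    (fun y => h y (nonZeroDivisors.coe_ne_zero y))
  let : Algebra K N := g.toAlgebra
  have : IsScalarTower W K N := .of_algebraMap_eq fun w => (IsLocalization.lift_eq _ w).symm
  have : Module.Flat W K := IsLocalization.flat K (nonZeroDivisors W)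
  exact Module.Flat.trans W K N

theorem goingDown_aux {W S N L : Type*} [CommRing W] [CommRing S] [CommRing N] [Field L]
    [Algebra W S] [Algebra W N] [Module.Flat W N]
    (f : S →+* L) (g : N →+* L) (hfg : f.comp (algebraMap W S) = g.comp (algebraMap W N))
    (n : Ideal S) [n.IsPrime] (hn : n ≤ RingHom.ker f) :
    ∃ (ψ : S ⊗[W] N →+* L) (P3 : Ideal (S ⊗[W] N)), P3.IsPrime ∧ P3 ≤ RingHom.ker ψ ∧
      (∀ s, ψ (s ⊗ₜ 1) = f s) ∧ (∀ n, ψ (1 ⊗ₜ n) = g n) ∧ P3.under S = n := by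
  let : Algebra S L := f.toAlgebra
  let : Algebra W L := (f.comp (algebraMap W S)).toAlgebra
  have : IsScalarTower W S L := .of_algebraMap_eq fun _ => rfl
  let g' : N →ₐ[W] L := { g with commutes' := fun w => (congr($hfg w)).symm }
  let ψ : S ⊗[W] N →ₐ[S] L := Algebra.TensorProduct.lift (Algebra.ofId S L) g' (fun _ _ => Commute.all _ _)
  let P2 := RingHom.ker ψ
  have hP2 : P2.IsPrime := RingHom.ker_isPrime _
  have hψ1 : ∀ s, ψ (s ⊗ₜ 1) = f s := fun s => by simp [ψ, Algebra.ofId_apply]; rfl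
  have hψ2 : ∀ s, ψ (1 ⊗ₜ s) = g s := fun s => by simp [ψ]; rfl
  have hle : n ≤ P2.under S := fun s hs => by
    change ψ (s ⊗ₜ 1) = 0
    rw [hψ1]; exact hn hs
  obtain ⟨P3, hP3le, hP3, hlo⟩ := Ideal.exists_ideal_le_liesOver_of_le (p := n) (q := P2.under S) P2 hle
  exact ⟨ψ.toRingHom, P3, hP3, hP3le, hψ1, hψ2, hlo.over.symm⟩

attribute [local instance] MvPolynomial.algebraMvPolynomial in
theorem algInd_tensor {B R1 R2 : Type u} {s : Type u} [CommRing B] [IsDomain B] [CommRing R1] [CommRing R2]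
    [Algebra B R1] [Algebra B R2] {P : Ideal (R1 ⊗[B] R2)} (hP : P ∈ minimalPrimes (R1 ⊗[B] R2))
    (b : s → R2)
    (hb : ∀ w : MvPolynomial s B, w ≠ 0 →
      (1 : R1) ⊗ₜ[B] (MvPolynomial.aeval b w) ∉ P)
    (f : MvPolynomial s R1) (hf : MvPolynomial.aeval (fun i => (1 : R1) ⊗ₜ[B] b i) f ∈ P) :
    f ∈ (P.under R1).map (MvPolynomial.C (σ := s)) := by
  have hPp : P.IsPrime := hP.1.1
  let C := R1 ⊗[B] R2
  let ρ : R2 →ₐ[B] C := Algebra.TensorProduct.includeRight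
  let Q2 := P.comap ρ
  have hQ2 : Q2.IsPrime := Ideal.comap_isPrime _ _
  let W := MvPolynomial s B
  let S := MvPolynomial s R1
  let N := Localization.AtPrime Q2
  let : Algebra W R2 := (MvPolynomial.aeval b).toAlgebra
  have : IsScalarTower B W R2 := .of_algebraMap_eq' (MvPolynomial.aeval b).comp_algebraMap.symm
  have : IsScalarTower B W N := .of_algebraMap_eq fun x => by
    rw [IsScalarTower.algebraMap_apply W R2 N, ← IsScalarTower.algebraMap_apply B W R2,
      IsScalarTower.algebraMap_apply B R2 N]
  have hflat : Module.Flat W N := by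
    refine flat_of_units fun w hw => ?_
    rw [IsScalarTower.algebraMap_apply W R2 N]
    exact IsLocalization.map_units N (⟨_, hb w hw⟩ : Q2.primeCompl)
  let L := FractionRing (C ⧸ P)
  let γ : C →+* L := (algebraMap (C ⧸ P) L).comp (Ideal.Quotient.mk P)
  have hγ : ∀ c, γ c = 0 ↔ c ∈ P := fun c => by
    rw [RingHom.comp_apply, map_eq_zero_iff _ (IsFractionRing.injective _ _), Ideal.Quotient.eq_zero_iff_mem]
  let α : S →ₐ[R1] C := MvPolynomial.aeval (fun i => (1 : R1) ⊗ₜ[B] b i)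
  let g : N →+* L := IsLocalization.lift (M := Q2.primeCompl) (g := γ.comp ρ.toRingHom) (fun y => by
    rw [isUnit_iff_ne_zero]
    exact fun h => y.2 ((hγ _).mp h))
  have hg : ∀ r, g (algebraMap R2 N r) = γ (ρ r) := fun r => IsLocalization.lift_eq _ r
  let n1 : Ideal S := (P.under R1).map (MvPolynomial.C (σ := s))
  have hn1 : n1.IsPrime := by
    have : n1 = RingHom.ker (MvPolynomial.map (σ := s) (Ideal.Quotient.mk (P.under R1))) := by
      rw [MvPolynomial.ker_map, Ideal.mk_ker]
    rw [this]; exact RingHom.ker_isPrime _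
  have hαW : ∀ w : W, α (algebraMap W S w) = ρ (algebraMap W R2 w) := by
    intro w
    change α (MvPolynomial.map (algebraMap B R1) w) = ρ (MvPolynomial.aeval b w)
    have : (α.restrictScalars B).comp (MvPolynomial.mapAlgHom (Algebra.ofId B R1)) =
        ρ.comp (MvPolynomial.aeval b) := by
      refine MvPolynomial.algHom_ext fun i => ?_
      change α (MvPolynomial.map _ (MvPolynomial.X i)) = ρ (MvPolynomial.aeval b (MvPolynomial.X i))
      rw [MvPolynomial.map_X, MvPolynomial.aeval_X, MvPolynomial.aeval_X]; rfl
    exact congr($this w)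
  obtain ⟨ψ, P3, hP3, hP3le, h1, h2, h3⟩ := goingDown_aux (W := W) (N := N) (γ.comp α.toRingHom) g (by
    refine RingHom.ext fun w => ?_
    change γ (α (algebraMap W S w)) = g (algebraMap W N w)
    rw [hαW, IsScalarTower.algebraMap_apply W R2 N, hg]) n1 (by
    refine Ideal.map_le_iff_le_comap.mpr fun r hr => ?_
    change γ (α (MvPolynomial.C r)) = 0
    rw [MvPolynomial.aeval_C, hγ]
    exact hr)
  let φ : C →ₐ[B] S ⊗[W] N := Algebra.TensorProduct.lift
    (((Algebra.TensorProduct.includeLeft : S →ₐ[W] S ⊗[W] N).restrictScalars B).comp (IsScalarTower.toAlgHom B R1 S))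
    (((Algebra.TensorProduct.includeRight : N →ₐ[W] S ⊗[W] N).restrictScalars B).comp (IsScalarTower.toAlgHom B R2 N))
    (fun _ _ => Commute.all _ _)
  have hφ1 : ∀ r, φ (r ⊗ₜ 1) = (MvPolynomial.C r) ⊗ₜ 1 := fun r => by
    refine (Algebra.TensorProduct.lift_tmul _ _ _ _ _).trans ?_
    rw [map_one, mul_one]; rfl
  have hφ2 : ∀ r, φ (1 ⊗ₜ r) = 1 ⊗ₜ (algebraMap R2 N r) := fun r => by
    refine (Algebra.TensorProduct.lift_tmul _ _ _ _ _).trans ?_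
    rw [map_one, one_mul]; rfl
  have hψφ : ψ.comp φ.toRingHom = γ := by
    refine RingHom.ext fun t => ?_
    change ψ (φ t) = γ t
    induction t using TensorProduct.induction_on with
    | zero => simp
    | add a b ha hb => simpa using congr($ha + $hb)
    | tmul a b =>
      have : a ⊗ₜ[B] b = (a ⊗ₜ 1) * (1 ⊗ₜ b) := by simp
      rw [this, map_mul, map_mul, map_mul, hφ1, hφ2, h1, h2, hg]
      change γ (α _) * _ = _
      rw [MvPolynomial.aeval_C]; rfl
  have hPP : P ≤ P3.comap φ := hP.2 ⟨Ideal.comap_isPrime _ _, bot_le⟩ (fun t ht => by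
    rw [← hγ, ← hψφ]
    exact hP3le ht)
  have hφα : ∀ f, φ (α f) = algebraMap S (S ⊗[W] N) f := by
    intro f
    have : φ.toRingHom.comp α.toRingHom = algebraMap S (S ⊗[W] N) := by
      refine MvPolynomial.ringHom_ext ?_ ?_
      · intro r
        change φ (α (MvPolynomial.C r)) = _
        rw [MvPolynomial.aeval_C]; exact hφ1 r
      · intro i
        change φ (α (MvPolynomial.X i)) = (MvPolynomial.X i) ⊗ₜ 1
        rw [MvPolynomial.aeval_X, hφ2]
        have e1 : algebraMap R2 N (b i) = (MvPolynomial.X i : W) • (1 : N) := by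
          rw [Algebra.smul_def, mul_one, IsScalarTower.algebraMap_apply W R2 N]
          congr 1
          exact (MvPolynomial.aeval_X b i).symm
        have e2 : (MvPolynomial.X i : S) = (MvPolynomial.X i : W) • (1 : S) := by
          rw [Algebra.smul_def, mul_one]; exact (MvPolynomial.map_X _ _).symm
        rw [e1, e2, smul_tmul]
    exact congr($this f)
  have := hPP hf
  rw [Ideal.mem_comap] at this
  change φ (α f) ∈ P3 at this
  rw [hφα] at this
  have : f ∈ P3.under S := this
  rwa [h3] at this

theorem L9 {B R1 R2 : Type u} [CommRing B] [IsDomain B] [CommRing R1] [CommRing R2]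
    [Algebra B R1] [Algebra B R2] {P : Ideal (R1 ⊗[B] R2)} (hP : P ∈ minimalPrimes (R1 ⊗[B] R2))
    (hPB : P.under B = ⊥) :
    Algebra.trdeg B (R1 ⧸ P.under R1) +
    Algebra.trdeg B (R2 ⧸ P.comap (Algebra.TensorProduct.includeRight : R2 →ₐ[B] R1 ⊗[B] R2)) ≤
      Algebra.trdeg B (R1 ⊗[B] R2 ⧸ P) := by
  have hPp : P.IsPrime := hP.1.1
  set Q1 := P.under R1
  set Q2 := P.comap (Algebra.TensorProduct.includeRight : R2 →ₐ[B] R1 ⊗[B] R2) with hQ2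
  have hQ2p : Q2.IsPrime := Ideal.comap_isPrime _ _
  have hf1 : FaithfulSMul B (R1 ⧸ Q1) := faithful_quot _ (by rw [Ideal.under_under, hPB])
  have hf2 : FaithfulSMul B (R2 ⧸ Q2) := faithful_quot _ (by
    rw [← hPB]; ext b
    simp [Q2, Ideal.mem_comap])
  have hf3 : FaithfulSMul (R1 ⧸ Q1) (R1 ⊗[B] R2 ⧸ P) := inferInstance
  have h1 := trdeg_add_eq B (R1 ⧸ Q1) (A := R1 ⊗[B] R2 ⧸ P)
  rw [← h1]
  gcongr
  obtain ⟨s, hs⟩ := exists_isTranscendenceBasis B (R2 ⧸ Q2)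
  rw [← hs.cardinalMk_eq_trdeg]
  choose b hb using fun i : s => Ideal.Quotient.mk_surjective (I := Q2) i.1
  suffices AlgebraicIndependent (R1 ⧸ Q1) (fun i : s => Ideal.Quotient.mk P (1 ⊗ₜ b i)) from
    this.cardinalMk_le_trdeg
  rw [algebraicIndependent_iff]
  intro g hg
  obtain ⟨f, rfl⟩ := MvPolynomial.map_surjective (Ideal.Quotient.mk Q1) Ideal.Quotient.mk_surjective g
  have hfP : MvPolynomial.aeval (fun i => (1 : R1) ⊗ₜ[B] b i) f ∈ P := by
    rw [← Ideal.Quotient.eq_zero_iff_mem, ← hg]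
    have : ((Ideal.Quotient.mkₐ R1 P).comp (MvPolynomial.aeval (fun i => (1 : R1) ⊗ₜ[B] b i))).toRingHom =
      ((MvPolynomial.aeval fun i : s => Ideal.Quotient.mk P (1 ⊗ₜ b i)).toRingHom).comp
        (MvPolynomial.map (Ideal.Quotient.mk Q1)) := by
      refine MvPolynomial.ringHom_ext ?_ ?_
      · intro r
        change Ideal.Quotient.mk P (MvPolynomial.aeval _ (MvPolynomial.C r)) =
          MvPolynomial.aeval _ (MvPolynomial.map _ (MvPolynomial.C r))
        rw [MvPolynomial.aeval_C, MvPolynomial.map_C, MvPolynomial.aeval_C]; rfl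
      · intro i
        change Ideal.Quotient.mk P (MvPolynomial.aeval _ (MvPolynomial.X i)) =
          MvPolynomial.aeval _ (MvPolynomial.map _ (MvPolynomial.X i))
        rw [MvPolynomial.aeval_X, MvPolynomial.map_X, MvPolynomial.aeval_X]
    exact congr($this f)
  have := algInd_tensor hP b (by
    intro w hw hwP
    apply hw
    refine (algebraicIndependent_iff.mp hs.1) w ?_
    have h5 : (Ideal.Quotient.mkₐ B Q2).comp (MvPolynomial.aeval b) = MvPolynomial.aeval ((↑) : s → R2 ⧸ Q2) := by
      refine MvPolynomial.algHom_ext fun i => ?_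
      change Ideal.Quotient.mk Q2 (MvPolynomial.aeval b (MvPolynomial.X i)) = _
      rw [MvPolynomial.aeval_X, MvPolynomial.aeval_X, hb]
    rw [← h5]
    exact Ideal.Quotient.eq_zero_iff_mem.mpr hwP) f hfP
  rw [← RingHom.mem_ker, MvPolynomial.ker_map, Ideal.mk_ker]
  exact this


theorem trdeg_tensor {B A : Type u} [CommRing B] [IsDomain B] [CommRing A] [Algebra B A] (d : ℕ)
    [Algebra (MvPolynomial (Fin d) B) A] [IsScalarTower B (MvPolynomial (Fin d) B) A]
    [Module.Flat (MvPolynomial (Fin d) B) A] (I I' : Ideal A) (j j' : ℕ)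
    [Module.Flat B (A ⧸ I)] [Module.Flat B (A ⧸ I')]
    (hI : ∀ p ∈ I.minimalPrimes, p.height ≤ j) (hI' : ∀ p ∈ I'.minimalPrimes, p.height ≤ j')
    (P : Ideal ((A ⧸ I) ⊗[B] (A ⧸ I'))) (hP : P ∈ minimalPrimes ((A ⧸ I) ⊗[B] (A ⧸ I'))) :
    ((2 * d : ℕ) : Cardinal) ≤ Algebra.trdeg B ((A ⧸ I) ⊗[B] (A ⧸ I') ⧸ P) + (j + j' : ℕ) := by
  have hPp : P.IsPrime := hP.1.1
  have hPB : P.under B = ⊥ := under_bot_of_minimal (by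
    intro b hb c hc
    rw [← Algebra.smul_def] at hc
    exact (smul_eq_zero.mp hc).resolve_left hb) hP
  have h9 := L9 hP hPB
  have hQ1 := minimal_includeLeft hP
  have hQ2 := minimal_includeRight hP
  have hB1 : (P.under (A ⧸ I)).under B = ⊥ := by rw [Ideal.under_under, hPB]
  have hB2 : (P.comap (Algebra.TensorProduct.includeRight : (A ⧸ I') →ₐ[B] (A ⧸ I) ⊗[B] (A ⧸ I'))).under B
      = ⊥ := by rw [← hPB]; ext b; simp [Ideal.mem_comap]
  have key : ∀ (I : Ideal A) (j : ℕ) (hI : ∀ p ∈ I.minimalPrimes, p.height ≤ j) (Q : Ideal (A ⧸ I))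
      (hQ : Q ∈ minimalPrimes (A ⧸ I)) (hB : Q.under B = ⊥),
      (d : Cardinal) ≤ Algebra.trdeg B ((A ⧸ I) ⧸ Q) + j := by
    intro I j hI Q hQ hB
    have hQp : Q.IsPrime := hQ.1.1
    have h1 := L10 d (Q.under A) (by rw [Ideal.under_under (A := B) (B := A), hB]) j (hI _ (by
      rw [Ideal.minimalPrimes_eq_comap]; exact ⟨Q, hQ, rfl⟩))
    refine h1.trans ?_
    gcongr
    exact trdeg_quot_le Q
  have k1 := key I j hI _ hQ1 hB1
  have k2 := key I' j' hI' _ hQ2 hB2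
  calc ((2 * d : ℕ) : Cardinal) = d + d := by push_cast; ring
    _ ≤ _ := add_le_add k1 k2
    _ = (Algebra.trdeg B ((A ⧸ I) ⧸ P.under (A ⧸ I)) + Algebra.trdeg B ((A ⧸ I') ⧸ P.comap
      (Algebra.TensorProduct.includeRight : (A ⧸ I') →ₐ[B] (A ⧸ I) ⊗[B] (A ⧸ I')))) + (j + j' : ℕ) := by
        push_cast; ring
    _ ≤ _ := add_le_add_left h9 _


theorem trdeg_drop {k D D' : Type u} [CommRing k] [IsDomain k] [CommRing D] [IsDomain D] [CommRing D']
    [IsDomain D'] [Algebra k D] [Algebra k D'] [FaithfulSMul k D'] (f : D →ₐ[k] D')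
    (hf : Function.Surjective f) (a : D) (ha : a ≠ 0) (hfa : f a = 0)
    (hfin : Algebra.trdeg k D < Cardinal.aleph0) : Algebra.trdeg k D' < Algebra.trdeg k D := by
  by_contra! h
  obtain ⟨s, hs⟩ := exists_isTranscendenceBasis k D'
  choose b hb using fun i : s => hf i.1
  have hfb : f ∘ b = ((↑) : s → D') := funext hb
  have hbi : AlgebraicIndependent k b := AlgebraicIndependent.of_comp f (hfb ▸ hs.1)
  have hsf : Finite s := Cardinal.lt_aleph0_iff_finite.mp (hbi.cardinalMk_le_trdeg.trans_lt hfin)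
  have hbt := hbi.isTranscendenceBasis_of_trdeg_le_of_finite (h.trans hs.cardinalMk_eq_trdeg.symm.le)
  have := hbt.isAlgebraic
  obtain ⟨r, hr, hdvd⟩ := (Algebra.IsAlgebraic.isAlgebraic (R := Algebra.adjoin k (Set.range b)) a).exists_nonzero_dvd
    (mem_nonZeroDivisors_of_ne_zero ha)
  obtain ⟨c, hc⟩ := hdvd
  have hfr : f r.1 = 0 := by
    have : f r.1 = f (a * c) := congrArg f hc
    rw [this, map_mul, hfa, zero_mul]
  have hr2 : r.1 ∈ (MvPolynomial.aeval (R := k) b).range := by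
    rw [← Algebra.adjoin_range_eq_range_aeval]; exact r.2
  obtain ⟨g, hg⟩ := hr2
  have h1 : MvPolynomial.aeval ((↑) : s → D') g = 0 := by
    rw [← hfb, ← hfr, ← hg]
    exact (MvPolynomial.comp_aeval_apply b f g).symm
  have : g = 0 := (algebraicIndependent_iff.mp hs.1) g h1
  apply hr
  apply Subtype.ext
  rw [← hg, this]; simp

theorem trdeg_fiber_le {B A : Type u} [CommRing B] [CommRing A] [Algebra B A] (d : ℕ)
    [Algebra (MvPolynomial (Fin d) B) A] [IsScalarTower B (MvPolynomial (Fin d) B) A]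
    (p : Ideal A) [p.IsPrime] [Algebra.QuasiFiniteAt (MvPolynomial (Fin d) B) p]
    (q : Ideal B) [p.LiesOver q] :
    Algebra.trdeg (B ⧸ q) (A ⧸ p) ≤ d := by
  let W := MvPolynomial (Fin d) B
  let v : Fin d → A ⧸ p := fun i => Ideal.Quotient.mk p (algebraMap W A (MvPolynomial.X i))
  let S := Algebra.adjoin (B ⧸ q) (Set.range v)
  have hmem : ∀ w : W, Ideal.Quotient.mk p (algebraMap W A w) ∈ S := by
    intro w
    induction w using MvPolynomial.induction_on with
    | C b =>
      have : Ideal.Quotient.mk p (algebraMap W A (MvPolynomial.C b)) =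
          algebraMap (B ⧸ q) (A ⧸ p) (Ideal.Quotient.mk q b) := by
        rw [← MvPolynomial.algebraMap_eq, ← IsScalarTower.algebraMap_apply B W A]
        rfl
      rw [this]; exact S.algebraMap_mem _
    | add a b ha hb => rw [map_add, map_add]; exact S.add_mem ha hb
    | mul_X a i ha => rw [map_mul, map_mul]; exact S.mul_mem ha (Algebra.subset_adjoin ⟨i, rfl⟩)
  let θ : W →+* S := ((Ideal.Quotient.mk p).comp (algebraMap W A)).codRestrict S hmem
  have hθ : ∀ w, (θ w = 0 ↔ w ∈ p.under W) := by
    intro w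
    rw [← Subtype.coe_inj]
    exact Ideal.Quotient.eq_zero_iff_mem
  have : Algebra.IsAlgebraic S (A ⧸ p) := by
    refine ⟨fun a => ?_⟩
    obtain ⟨s, rfl⟩ := Ideal.Quotient.mk_surjective a
    obtain ⟨f, ⟨i, hi⟩, hf⟩ := qf_algebraic (R := W) p s
    refine ⟨f.map θ, ?_, ?_⟩
    · intro h0
      apply hi
      rw [← hθ, ← Polynomial.coeff_map, h0, Polynomial.coeff_zero]
    · rw [← Ideal.Quotient.eq_zero_iff_mem] at hf
      rw [← hf, Polynomial.aeval_def, Polynomial.eval₂_map, Polynomial.aeval_def,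
        Polynomial.hom_eval₂]
      rfl
  refine (Algebra.IsAlgebraic.trdeg_le_cardinalMk (B ⧸ q) (Set.range v)).trans ?_
  rw [← Cardinal.lift_uzero (Cardinal.mk (Set.range v))]
  refine Cardinal.mk_range_le_lift.trans ?_
  simp

theorem trdeg_chain {B A : Type u} [CommRing B] [CommRing A] [Algebra B A] (d : ℕ)
    [Algebra (MvPolynomial (Fin d) B) A] [IsScalarTower B (MvPolynomial (Fin d) B) A]
    [Algebra.QuasiFinite (MvPolynomial (Fin d) B) A]
    (q : Ideal B) [q.IsPrime] (L : LTSeries (PrimeSpectrum A)) (hL : ∀ i, (L i).asIdeal.under B = q)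
    (x : Ideal A) [x.LiesOver q] (hx : L.last.asIdeal = x) :
    Algebra.trdeg (B ⧸ q) (A ⧸ x) + L.length ≤ d := by
  have key : ∀ (i : ℕ) (hi : i ≤ L.length) (p : Ideal A) [p.LiesOver q],
      p = (L ⟨i, by omega⟩).asIdeal → Algebra.trdeg (B ⧸ q) (A ⧸ p) + i ≤ d := by
    intro i
    induction i with
    | zero =>
      intro hi p _ hp
      have : p.IsPrime := hp ▸ inferInstance
      simpa using trdeg_fiber_le d p q
    | succ i ih =>
      intro hi p _ hp
      have hpp : p.IsPrime := hp ▸ inferInstance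
      let p' := (L ⟨i, by omega⟩).asIdeal
      have : p'.LiesOver q := ⟨(hL _).symm⟩
      have h1 := ih (by omega) p' rfl
      have hlt : p' < p := by
        rw [hp]
        exact L.strictMono (by simp [Fin.lt_def])
      obtain ⟨a, hap, hap'⟩ := SetLike.exists_of_lt hlt
      let f : A ⧸ p' →ₐ[B ⧸ q] A ⧸ p :=
        { Ideal.Quotient.factor hlt.le with
          commutes' := by
            intro b
            obtain ⟨b, rfl⟩ := Ideal.Quotient.mk_surjective b
            rfl }
      have h2 := trdeg_drop f (Ideal.Quotient.factor_surjective hlt.le) (Ideal.Quotient.mk p' a)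
        (by rwa [Ne, Ideal.Quotient.eq_zero_iff_mem])
        (Ideal.Quotient.eq_zero_iff_mem.mpr hap) ((trdeg_fiber_le d p' q).trans_lt Cardinal.natCast_lt_aleph0)
      have h3 : Algebra.trdeg (B ⧸ q) (A ⧸ p) + 1 ≤ Algebra.trdeg (B ⧸ q) (A ⧸ p') :=
        Cardinal.add_one_le_of_lt h2
      push_cast
      calc _ = (Algebra.trdeg (B ⧸ q) (A ⧸ p) + 1) + i := by ring
        _ ≤ _ := (add_le_add_left h3 _).trans h1
  exact key L.length le_rfl x hx.symm


theorem qf_of_max {B A : Type u} [CommRing B] [CommRing A] [Algebra B A] [Algebra.FiniteType B A]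
    (p : Ideal A) [p.IsPrime] (q : Ideal B) [p.LiesOver q] :
    (∀ y : Ideal A, y.IsPrime → p ≤ y → y.under B = q → y = p) ↔ Algebra.IsAlgebraic (B ⧸ q) (A ⧸ p) := by
  have hq : q.IsPrime := by rw [Ideal.over_def p q]; infer_instance
  have : Algebra.FiniteType (B ⧸ q) (A ⧸ p) := .of_restrictScalars_finiteType B _ _
  have hinj : Function.Injective (algebraMap (B ⧸ q) (A ⧸ p)) := FaithfulSMul.algebraMap_injective _ _
  have hbot : (⊥ : Ideal (A ⧸ p)).under (B ⧸ q) = ⊥ := by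
    rw [eq_bot_iff]
    intro b hb
    exact hinj (by rw [map_zero]; exact hb)
  constructor
  · intro h
    have : Algebra.QuasiFiniteAt (B ⧸ q) (⊥ : Ideal (A ⧸ p)) := by
      rw [qf_iff]
      intro y hy _ hyu
      rw [hbot] at hyu
      have h1 := h (y.comap (Ideal.Quotient.mk p)) inferInstance (by
        intro a ha
        rw [Ideal.mem_comap, Ideal.Quotient.eq_zero_iff_mem.mpr ha]; exact y.zero_mem) (by
        ext b
        have : Ideal.Quotient.mk q b ∈ y.under (B ⧸ q) ↔ Ideal.Quotient.mk q b ∈ (⊥ : Ideal (B ⧸ q)) := by rw [hyu]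
        rw [Ideal.mem_bot, Ideal.Quotient.eq_zero_iff_mem] at this
        exact this)
      rw [eq_bot_iff]
      intro a ha
      obtain ⟨a, rfl⟩ := Ideal.Quotient.mk_surjective a
      have h2 : a ∈ y.comap (Ideal.Quotient.mk p) := ha
      rw [h1] at h2
      exact Ideal.Quotient.eq_zero_iff_mem.mpr h2
    refine ⟨fun a => ?_⟩
    obtain ⟨f, ⟨i, hi⟩, hf⟩ := qf_algebraic (R := B ⧸ q) (⊥ : Ideal (A ⧸ p)) a
    refine ⟨f, fun h0 => hi ?_, hf⟩
    rw [h0]; simp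
  · intro halg y hy hpy hyq
    refine le_antisymm ?_ hpy
    intro a hay
    by_contra hap
    obtain ⟨r, hr, hdvd⟩ := (Algebra.IsAlgebraic.isAlgebraic (R := B ⧸ q) (Ideal.Quotient.mk p a)).exists_nonzero_dvd
      (mem_nonZeroDivisors_of_ne_zero (by rwa [Ne, Ideal.Quotient.eq_zero_iff_mem]))
    obtain ⟨b, rfl⟩ := Ideal.Quotient.mk_surjective r
    rw [Ne, Ideal.Quotient.eq_zero_iff_mem] at hr
    apply hr
    rw [← hyq]
    obtain ⟨c, hc⟩ := hdvd
    obtain ⟨c, rfl⟩ := Ideal.Quotient.mk_surjective c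
    rw [← map_mul, Ideal.Quotient.algebraMap_mk_of_liesOver, Ideal.Quotient.eq] at hc
    have := y.add_mem (hpy hc) (y.mul_mem_right c hay)
    rwa [sub_add_cancel] at this

theorem exists_trbasis {B A : Type u} [CommRing B] [CommRing A] [Algebra B A]
    (x : Ideal A) [x.IsPrime] (q : Ideal B) [x.LiesOver q]
    (hfin : Algebra.trdeg (B ⧸ q) (A ⧸ x) < Cardinal.aleph0) :
    ∃ (t : ℕ) (y : Fin t → A), (t : Cardinal) = Algebra.trdeg (B ⧸ q) (A ⧸ x) ∧
      ∀ p : Ideal A, p.IsPrime → x ≤ p →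
      (∀ f : MvPolynomial (Fin t) B, MvPolynomial.aeval y f ∈ p ↔ MvPolynomial.aeval y f ∈ x) → p = x := by
  have hq : q.IsPrime := by rw [Ideal.over_def x q]; infer_instance
  obtain ⟨s, hs⟩ := exists_isTranscendenceBasis (B ⧸ q) (A ⧸ x)
  have hsf : Finite s := Cardinal.lt_aleph0_iff_finite.mp (hs.cardinalMk_eq_trdeg ▸ hfin)
  choose b hb using fun i : s => Ideal.Quotient.mk_surjective i.1
  let e := Finite.equivFin s
  refine ⟨Nat.card s, b ∘ e.symm, ?_, ?_⟩
  · rw [← hs.cardinalMk_eq_trdeg, Nat.cast_card]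
  intro p hp hxp hf
  refine le_antisymm ?_ hxp
  intro a hap
  by_contra hax
  have := hs.isAlgebraic
  obtain ⟨r, hr, hdvd⟩ := (Algebra.IsAlgebraic.isAlgebraic
      (R := Algebra.adjoin (B ⧸ q) (Set.range ((↑) : s → A ⧸ x))) (Ideal.Quotient.mk x a)).exists_nonzero_dvd
      (mem_nonZeroDivisors_of_ne_zero (by rwa [Ne, Ideal.Quotient.eq_zero_iff_mem]))
  have hr2 : r.1 ∈ (MvPolynomial.aeval (R := B ⧸ q) ((↑) : s → A ⧸ x)).range := by
    rw [← Algebra.adjoin_range_eq_range_aeval]; exact r.2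
  obtain ⟨g, hg⟩ := hr2
  obtain ⟨g, rfl⟩ := MvPolynomial.map_surjective (Ideal.Quotient.mk q) Ideal.Quotient.mk_surjective g
  have hgx : Ideal.Quotient.mk x (MvPolynomial.aeval b g) = r.1 := by
    rw [← hg]
    have : ((Ideal.Quotient.mk x).comp (MvPolynomial.aeval b).toRingHom) =
        ((MvPolynomial.aeval (R := B ⧸ q) ((↑) : s → A ⧸ x)).toRingHom).comp (MvPolynomial.map (Ideal.Quotient.mk q)) := by
      refine MvPolynomial.ringHom_ext ?_ ?_
      · intro r
        change Ideal.Quotient.mk x (MvPolynomial.aeval _ (MvPolynomial.C r)) =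
          MvPolynomial.aeval _ (MvPolynomial.map _ (MvPolynomial.C r))
        rw [MvPolynomial.aeval_C, MvPolynomial.map_C, MvPolynomial.aeval_C]; rfl
      · intro i
        change Ideal.Quotient.mk x (MvPolynomial.aeval _ (MvPolynomial.X i)) =
          MvPolynomial.aeval _ (MvPolynomial.map _ (MvPolynomial.X i))
        rw [MvPolynomial.aeval_X, MvPolynomial.map_X, MvPolynomial.aeval_X, hb]
    exact congr($this g)
  have hren : MvPolynomial.aeval (b ∘ e.symm) (MvPolynomial.rename e g) = MvPolynomial.aeval b g := by
    rw [MvPolynomial.aeval_rename]; congr 2; funext i; exact congrArg b (e.symm_apply_apply i)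
  have h3 := hf (MvPolynomial.rename e g)
  rw [hren] at h3
  apply hr
  apply Subtype.ext
  rw [← hgx]
  refine Ideal.Quotient.eq_zero_iff_mem.mpr (h3.mp ?_)
  obtain ⟨c, hc⟩ := hdvd
  obtain ⟨c, rfl⟩ := Ideal.Quotient.mk_surjective c
  have hc : r.1 = _ := hc
  rw [← map_mul, ← hgx, Ideal.Quotient.eq] at hc
  have := p.add_mem (hxp hc) (p.mul_mem_right c hap)
  rwa [sub_add_cancel] at this


theorem unram_eq {W A E F : Type*} [CommRing W] [CommRing A] [Algebra W A] [CommRing E] [IsDomain E]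
    [CommRing F] [Nontrivial F] [Algebra.FormallyUnramified W A] [Algebra.EssFiniteType W A]
    (f1 f2 : A →+* E) (f : E →+* F) (h : ∀ a, f (f1 a) = f (f2 a))
    (hW : ∀ w : W, f1 (algebraMap W A w) = f2 (algebraMap W A w)) (a : A) : f1 a = f2 a := by
  letI : Algebra W E := (f1.comp (algebraMap W A)).toAlgebra
  let g1 : A →ₐ[W] E := { f1 with commutes' := fun w => rfl }
  let g2 : A →ₐ[W] E := { f2 with commutes' := fun w => (hW w).symm }
  obtain ⟨τ, hτ, hτ1⟩ := Algebra.FormallyUnramified.iff_exists_tensorProduct.mp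
    (inferInstance : Algebra.FormallyUnramified W A)
  let σ : A ⊗[W] A →ₐ[W] E := Algebra.TensorProduct.lift g1 g2 (fun _ _ => .all _ _)
  have hσ : ∀ u v, σ (u ⊗ₜ v) = f1 u * f2 v := fun u v => Algebra.TensorProduct.lift_tmul _ _ _ _ _
  have h1 : ∀ z, f (σ z) = f (f1 (Algebra.TensorProduct.lmul' W z)) := by
    intro z
    induction z with
    | zero => simp
    | tmul u v => rw [hσ, Algebra.TensorProduct.lmul'_apply_tmul, map_mul, map_mul, map_mul, h v]
    | add u v hu hv => rw [map_add, map_add, hu, hv, map_add, map_add, map_add]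
  have h2 : σ τ ≠ 0 := by
    intro h0
    have := h1 τ
    rw [h0, hτ1] at this
    simp at this
  have h3 := congrArg σ (hτ a)
  rw [map_mul, map_zero, map_sub, hσ, hσ] at h3
  rcases mul_eq_zero.mp h3 with h4 | h4
  · rw [map_one, map_one, one_mul, mul_one, sub_eq_zero] at h4; exact h4.symm
  · exact absurd h4 h2

theorem diag_of_le {B A C : Type*} [CommRing B] [CommRing A] [Algebra B A] [CommRing C] [Algebra B C] (d : ℕ)
    [Algebra (MvPolynomial (Fin d) B) A] [IsScalarTower B (MvPolynomial (Fin d) B) A]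
    [Algebra.FormallyUnramified (MvPolynomial (Fin d) B) A] [Algebra.EssFiniteType (MvPolynomial (Fin d) B) A]
    (ρ1 ρ2 : A →ₐ[B] C) (x p : Ideal C) [x.IsPrime] [p.IsPrime] (hpx : p ≤ x)
    (hx : ∀ a, ρ1 a - ρ2 a ∈ x)
    (hp : ∀ i, ρ1 (algebraMap (MvPolynomial (Fin d) B) A (.X i)) -
      ρ2 (algebraMap (MvPolynomial (Fin d) B) A (.X i)) ∈ p) (a : A) : ρ1 a - ρ2 a ∈ p := by
  rw [← Ideal.Quotient.eq]
  refine unram_eq (W := MvPolynomial (Fin d) B) ((Ideal.Quotient.mk p).comp ρ1.toRingHom)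
    ((Ideal.Quotient.mk p).comp ρ2.toRingHom) (Ideal.Quotient.factor hpx) ?_ ?_ a
  · intro a
    exact Ideal.Quotient.eq.mpr (hx a)
  · intro w
    have : ((Ideal.Quotient.mk p).comp ρ1.toRingHom).comp (algebraMap (MvPolynomial (Fin d) B) A) =
      ((Ideal.Quotient.mk p).comp ρ2.toRingHom).comp (algebraMap (MvPolynomial (Fin d) B) A) := by
      refine MvPolynomial.ringHom_ext ?_ ?_
      · intro b
        change Ideal.Quotient.mk p (ρ1 (algebraMap _ A (algebraMap B (MvPolynomial (Fin d) B) b))) =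
          Ideal.Quotient.mk p (ρ2 (algebraMap _ A (algebraMap B (MvPolynomial (Fin d) B) b)))
        rw [← IsScalarTower.algebraMap_apply, AlgHom.commutes, AlgHom.commutes]
      · intro i
        exact Ideal.Quotient.eq.mpr (hp i)
    exact congr($this w)

theorem ideal_ext_red {A C : Type*} [CommRing A] [CommRing C] (ρ1 ρ2 : A →+* C)
    (hred : ∀ J : Ideal C, (∀ a, ρ1 a - ρ2 a ∈ J) → ∀ c, ∃ a, c - ρ1 a ∈ J)
    (x y : Ideal C) (hx : ∀ a, ρ1 a - ρ2 a ∈ x) (hy : ∀ a, ρ1 a - ρ2 a ∈ y)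
    (h : x.comap ρ1 ≤ y.comap ρ1) : x ≤ y := by
  intro c hc
  obtain ⟨a, ha⟩ := hred (x ⊓ y) (fun a => ⟨hx a, hy a⟩) c
  have h1 : ρ1 a ∈ x := by simpa using x.sub_mem hc ha.1
  have h2 : ρ1 a ∈ y := h h1
  simpa using y.add_mem ha.2 h2

theorem etale_abstract {B A C : Type u} [CommRing B] [IsDomain B] [CommRing A] [Algebra B A] [Algebra.FiniteType B A]
    [CommRing C] [Algebra B C] [Module.Flat B C] [Algebra.FiniteType B C] (d : ℕ)
    [Algebra (MvPolynomial (Fin d) B) A] [IsScalarTower B (MvPolynomial (Fin d) B) A]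
    [Algebra.FormallyUnramified (MvPolynomial (Fin d) B) A] [Algebra.EssFiniteType (MvPolynomial (Fin d) B) A]
    (ρ1 ρ2 : A →ₐ[B] C) (I I' : Ideal A) (j : ℕ)
    (hρ1 : ∀ a ∈ I, ρ1 a = 0) (hρ2 : ∀ a ∈ I', ρ2 a = 0)
    (hred : ∀ J : Ideal C, (∀ a, ρ1 a - ρ2 a ∈ J) → ∀ c, ∃ a, c - ρ1 a ∈ J)
    (hlift : ∀ y : Ideal A, I ≤ y → I' ≤ y → ∃ π : C →ₐ[B] A ⧸ y, (∀ a, π (ρ1 a) = Ideal.Quotient.mk y a) ∧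
      (∀ a, π (ρ2 a) = Ideal.Quotient.mk y a))
    (htr : ∀ P ∈ minimalPrimes C, ((2 * d : ℕ) : Cardinal) ≤ Algebra.trdeg B (C ⧸ P) + (j : ℕ))
    (x : Ideal A) [x.IsPrime] (hIx : I ≤ x) (hI'x : I' ≤ x) (q : Ideal B) [q.IsPrime] [x.LiesOver q]
    (c : ℕ) (g : Fin c → A) (hg : ∀ i, g i ∈ x)
    (huniq : ∀ p : Ideal A, p.IsPrime → I ≤ p → I' ≤ p → p ≤ x → p.under B = q → (∀ i, g i ∈ p) → p = x)
    (L : LTSeries (PrimeSpectrum A)) (hL : ∀ i, (L i).asIdeal.under B = q) (hLx : L.last.asIdeal = x)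
    (hlen : L.length = j + c) (q' : Ideal B) [q'.IsPrime] (hq' : q' ≤ q) :
    ∃ p : Ideal A, p.IsPrime ∧ I ≤ p ∧ I' ≤ p ∧ p ≤ x ∧ p.under B = q' ∧
      ((∀ y : Ideal A, y.IsPrime → x ≤ y → y.under B = q → y = x) →
        ∀ y : Ideal A, y.IsPrime → p ≤ y → y.under B = q' → y = p) := by
  have hxq : q = x.under B := Ideal.over_def x q
  have hdim := trdeg_chain d q L hL x hLx
  have hfin : Algebra.trdeg (B ⧸ q) (A ⧸ x) < Cardinal.aleph0 :=
    lt_of_le_of_lt (le_trans (self_le_add_right _ _) hdim) (Cardinal.natCast_lt_aleph0)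
  obtain ⟨t, y, ht, hy⟩ := exists_trbasis x q hfin
  rw [← ht, hlen] at hdim
  have hdim : t + (j + c) ≤ d := by exact_mod_cast hdim
  -- tilde construction
  have htil : ∀ z : Ideal A, z.IsPrime → I ≤ z → I' ≤ z → ∃ z' : Ideal C, z'.IsPrime ∧ (∀ a, ρ1 a - ρ2 a ∈ z') ∧
      z'.comap ρ1.toRingHom = z := by
    intro z hz h1 h2
    obtain ⟨π, hπ1, hπ2⟩ := hlift z h1 h2
    refine ⟨RingHom.ker π, RingHom.ker_isPrime _, ?_, ?_⟩
    · intro a; rw [RingHom.mem_ker, map_sub, hπ1, hπ2, sub_self]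
    · ext a
      change π (ρ1 a) = 0 ↔ _
      rw [hπ1, Ideal.Quotient.eq_zero_iff_mem]
  obtain ⟨x', hx'p, hx'δ, hx'c⟩ := htil x inferInstance hIx hI'x
  have hunder : ∀ z : Ideal C, (z.comap ρ1.toRingHom).under B = z.under B := by
    intro z; ext b
    change ρ1 (algebraMap B A b) ∈ z ↔ algebraMap B C b ∈ z
    rw [AlgHom.commutes]
  have hI1 : ∀ z : Ideal C, I ≤ z.comap ρ1.toRingHom := by
    intro z a ha
    change ρ1 a ∈ z
    rw [hρ1 a ha]; exact z.zero_mem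
  have hI2 : ∀ z : Ideal C, (∀ a, ρ1 a - ρ2 a ∈ z) → I' ≤ z.comap ρ1.toRingHom := by
    intro z hz a ha
    change ρ1 a ∈ z
    have := hz a
    rwa [hρ2 a ha, sub_zero] at this
  have hmem : ∀ a, ρ1 a ∈ x' ↔ a ∈ x := by
    intro a
    rw [← hx'c]; rfl
  let v : (Fin d ⊕ Fin c) ⊕ Fin t → C := Sum.elim (Sum.elim
    (fun i => ρ1 (algebraMap (MvPolynomial (Fin d) B) A (.X i)) - ρ2 (algebraMap (MvPolynomial (Fin d) B) A (.X i)))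
    (fun i => ρ1 (g i))) (fun i => ρ1 (y i))
  have hext : ∀ z w : Ideal C, (∀ a, ρ1 a - ρ2 a ∈ z) → (∀ a, ρ1 a - ρ2 a ∈ w) →
      z.comap ρ1.toRingHom = w.comap ρ1.toRingHom → z = w := by
    intro z w hz hw h
    exact le_antisymm (ideal_ext_red ρ1.toRingHom ρ2.toRingHom hred z w hz hw h.le)
      (ideal_ext_red ρ1.toRingHom ρ2.toRingHom hred w z hw hz h.ge)
  obtain ⟨p, hp, hpx, hpq, hpS, hpmax⟩ := L7b x' v (Set.range Sum.inl) (by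
      rintro _ ⟨i | i, rfl⟩
      · exact hx'δ _
      · exact (hmem _).mpr (hg i)) (by
      intro p hp hcomp hiff
      have hXv : ∀ i, v i ∈ p ↔ v i ∈ x' := by
        intro i
        have := hiff (.X i)
        rwa [MvPolynomial.aeval_X] at this
      have hpB : p.under B = q := by
        ext b
        have := hiff (.C b)
        rw [MvPolynomial.aeval_C] at this
        refine this.trans ?_
        rw [← AlgHom.commutes ρ1, hmem, hxq]; rfl
      rcases hcomp with hle | hle
      · have hδ : ∀ a, ρ1 a - ρ2 a ∈ p := diag_of_le d ρ1 ρ2 x' p hle hx'δ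
          (fun i => (hXv (.inl (.inl i))).mpr (hx'δ _))
        refine hext _ _ hδ hx'δ ?_
        rw [hx'c]
        refine huniq _ inferInstance (hI1 p) (hI2 p hδ) ?_ ?_ ?_
        · rw [← hx'c]; exact Ideal.comap_mono hle
        · rw [hunder, hpB]
        · intro i
          exact (hXv (.inl (.inr i))).mpr ((hmem _).mpr (hg i))
      · have hδ : ∀ a, ρ1 a - ρ2 a ∈ p := fun a => hle (hx'δ a)
        refine hext _ _ hδ hx'δ ?_
        rw [hx'c]
        refine hy _ inferInstance ?_ ?_
        · rw [← hx'c]; exact Ideal.comap_mono hle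
        · intro f
          have := hiff (MvPolynomial.rename Sum.inr f)
          rw [MvPolynomial.aeval_rename] at this
          have he : MvPolynomial.aeval (v ∘ Sum.inr) f = ρ1 (MvPolynomial.aeval y f) := by
            rw [← AlgHom.comp_apply, MvPolynomial.comp_aeval]; rfl
          rw [he, hmem] at this
          exact this) (by
      intro P hP _
      have h1 := htr P hP
      have h2 : Nat.card ((Fin d ⊕ Fin c) ⊕ Fin t) + j ≤ 2 * d := by
        simp only [Nat.card_sum, Nat.card_fin]; omega
      have h3 : ((Nat.card ((Fin d ⊕ Fin c) ⊕ Fin t) : ℕ) : Cardinal) + (j : ℕ) ≤ Algebra.trdeg B (C ⧸ P) + (j : ℕ) := by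
        refine le_trans ?_ h1
        exact_mod_cast h2
      exact (Cardinal.add_le_add_iff_of_lt_aleph0 Cardinal.natCast_lt_aleph0).mp h3) q' (by
      rw [← hunder, hx'c, ← hxq]; exact hq')
  have hδ : ∀ a, ρ1 a - ρ2 a ∈ p := diag_of_le d ρ1 ρ2 x' p hpx hx'δ
      (fun i => hpS (.inl (.inl i)) ⟨_, rfl⟩)
  refine ⟨p.comap ρ1.toRingHom, inferInstance, hI1 p, hI2 p hδ, ?_, ?_, ?_⟩
  · rw [← hx'c]; exact Ideal.comap_mono hpx
  · rw [hunder, hpq]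
  · intro hxmax z hz hpz hzq
    have halg := (qf_of_max x q).mp hxmax
    have ht0 : t = 0 := by
      have := trdeg_eq_zero (R := B ⧸ q) (A := A ⧸ x)
      rw [← ht] at this
      exact_mod_cast this
    subst ht0
    have hS : Set.range (Sum.inl : Fin d ⊕ Fin c → (Fin d ⊕ Fin c) ⊕ Fin 0) = Set.univ := by
      ext i
      rcases i with i | i
      · simp
      · exact i.elim0
    obtain ⟨z', hz'p, hz'δ, hz'c⟩ := htil z hz ((hI1 p).trans hpz) ((hI2 p hδ).trans hpz)
    rw [← hz'c]
    rw [hpmax hS z' hz'p (ideal_ext_red ρ1.toRingHom ρ2.toRingHom hred p z' hδ hz'δ (by rw [hz'c]; exact hpz))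
      (by rw [← hunder, hz'c, hzq])]

theorem etale_case {B A : Type u} [CommRing B] [IsDomain B] [CommRing A] [Algebra B A] [Algebra.FiniteType B A]
    (d : ℕ)
    [Algebra (MvPolynomial (Fin d) B) A] [IsScalarTower B (MvPolynomial (Fin d) B) A]
    [Module.Flat (MvPolynomial (Fin d) B) A]
    [Algebra.FormallyUnramified (MvPolynomial (Fin d) B) A] [Algebra.EssFiniteType (MvPolynomial (Fin d) B) A]
    (I I' : Ideal A) (j j' : ℕ)
    [Module.Flat B (A ⧸ I)] [Module.Flat B (A ⧸ I')]
    (hI : ∀ p ∈ I.minimalPrimes, p.height ≤ j) (hI' : ∀ p ∈ I'.minimalPrimes, p.height ≤ j')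
    (x : Ideal A) [x.IsPrime] (hIx : I ≤ x) (hI'x : I' ≤ x) (q : Ideal B) [q.IsPrime] [x.LiesOver q]
    (c : ℕ) (g : Fin c → A) (hg : ∀ i, g i ∈ x)
    (huniq : ∀ p : Ideal A, p.IsPrime → I ≤ p → I' ≤ p → p ≤ x → p.under B = q → (∀ i, g i ∈ p) → p = x)
    (L : LTSeries (PrimeSpectrum A)) (hL : ∀ i, (L i).asIdeal.under B = q) (hLx : L.last.asIdeal = x)
    (hlen : L.length = j + j' + c) (q' : Ideal B) [q'.IsPrime] (hq' : q' ≤ q) :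
    ∃ p : Ideal A, p.IsPrime ∧ I ≤ p ∧ I' ≤ p ∧ p ≤ x ∧ p.under B = q' ∧
      ((∀ y : Ideal A, y.IsPrime → x ≤ y → y.under B = q → y = x) →
        ∀ y : Ideal A, y.IsPrime → p ≤ y → y.under B = q' → y = p) := by
  let ρ1 : A →ₐ[B] (A ⧸ I) ⊗[B] (A ⧸ I') :=
    (Algebra.TensorProduct.includeLeft : (A ⧸ I) →ₐ[B] (A ⧸ I) ⊗[B] (A ⧸ I')).comp (Ideal.Quotient.mkₐ B I)
  let ρ2 : A →ₐ[B] (A ⧸ I) ⊗[B] (A ⧸ I') :=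
    (Algebra.TensorProduct.includeRight : (A ⧸ I') →ₐ[B] (A ⧸ I) ⊗[B] (A ⧸ I')).comp (Ideal.Quotient.mkₐ B I')
  have e1 : ∀ a, ρ1 a = (Ideal.Quotient.mk I a) ⊗ₜ 1 := fun a => rfl
  have e2 : ∀ a, ρ2 a = 1 ⊗ₜ (Ideal.Quotient.mk I' a) := fun a => rfl
  have : Algebra.FiniteType (A ⧸ I) ((A ⧸ I) ⊗[B] (A ⧸ I')) := inferInstance
  have : Algebra.FiniteType B ((A ⧸ I) ⊗[B] (A ⧸ I')) := Algebra.FiniteType.trans (S := A ⧸ I) inferInstance inferInstance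
  refine etale_abstract d ρ1 ρ2 I I' (j + j') ?_ ?_ ?_ ?_ (trdeg_tensor d I I' j j' hI hI') x hIx hI'x q c g hg
    huniq L hL hLx hlen q' hq'
  · intro a ha
    rw [e1, Ideal.Quotient.eq_zero_iff_mem.mpr ha, zero_tmul]
  · intro a ha
    rw [e2, Ideal.Quotient.eq_zero_iff_mem.mpr ha, tmul_zero]
  · intro J hJ z
    induction z with
    | zero => exact ⟨0, by simp⟩
    | tmul u v =>
      obtain ⟨u, rfl⟩ := Ideal.Quotient.mk_surjective u
      obtain ⟨v, rfl⟩ := Ideal.Quotient.mk_surjective v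
      refine ⟨u * v, ?_⟩
      have h1 : (Ideal.Quotient.mk I u) ⊗ₜ[B] (Ideal.Quotient.mk I' v) = ρ1 u * ρ2 v := by
        rw [e1, e2, Algebra.TensorProduct.tmul_mul_tmul, one_mul, mul_one]
      rw [h1, map_mul, ← mul_sub, ← neg_sub]
      exact J.mul_mem_left _ (J.neg_mem (hJ v))
    | add u v hu hv =>
      obtain ⟨a, ha⟩ := hu
      obtain ⟨b, hb⟩ := hv
      refine ⟨a + b, ?_⟩
      rw [map_add, add_sub_add_comm]
      exact J.add_mem ha hb
  · intro y h1 h2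
    refine ⟨Algebra.TensorProduct.lift (Ideal.Quotient.factorₐ B h1) (Ideal.Quotient.factorₐ B h2)
      (fun _ _ => .all _ _), ?_, ?_⟩
    · intro a
      rw [e1, Algebra.TensorProduct.lift_tmul, map_one, mul_one]; rfl
    · intro a
      rw [e2, Algebra.TensorProduct.lift_tmul, map_one, one_mul]; rfl


theorem le_height_last {α : Type*} [PartialOrder α] (L : LTSeries α) (n : ℕ) (h : (n : ℕ∞) ≤ Order.height L.head) :
    ((n + L.length : ℕ) : ℕ∞) ≤ Order.height L.last := by
  obtain ⟨M, hM, hn⟩ := Order.exists_series_of_le_height _ h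
  have := Order.length_le_height_last (p := M.smash L hM)
  rw [RelSeries.last_smash] at this
  rw [← hn]
  exact this

theorem map_comap_of_units {A F : Type*} [CommRing A] [CommRing F] (φ : A →+* F)
    (h1 : ∀ z, ∃ u, IsUnit (φ u) ∧ ∃ a, φ u * z = φ a) (P : Ideal F) : (P.comap φ).map φ = P := by
  refine le_antisymm Ideal.map_comap_le ?_
  intro z hz
  obtain ⟨u, hu, a, ha⟩ := h1 z
  have : φ u * z ∈ (P.comap φ).map φ := by
    rw [ha]
    refine Ideal.mem_map_of_mem _ ?_
    rw [Ideal.mem_comap, ← ha]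
    exact P.mul_mem_left _ hz
  rwa [Ideal.unit_mul_mem_iff_mem _ hu] at this

theorem HF_abstract {A F : Type*} [CommRing A] [CommRing F] [IsNoetherianRing F]
    (φ : A →+* F) (T : Ideal A → Prop)
    (h1 : ∀ z, ∃ u, IsUnit (φ u) ∧ ∃ a, φ u * z = φ a)
    (h2 : ∀ p : Ideal A, p.IsPrime → T p → (p.map φ).IsPrime ∧ (p.map φ).comap φ = p)
    (h3 : ∀ P : Ideal F, P.IsPrime → T (P.comap φ))
    (J x : Ideal A) (hx : x.IsPrime) (hT : T x) (hJx : J ≤ x) (n : ℕ)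
    (hfib : ∀ P : Ideal F, P ∈ (J.map φ).minimalPrimes → P ≤ x.map φ → P.height = n) :
    ∃ (c : ℕ) (g : Fin c → A) (L : LTSeries (PrimeSpectrum A)), (∀ i, g i ∈ x) ∧
      (∀ p : Ideal A, p.IsPrime → J ≤ p → p ≤ x → T p → (∀ i, g i ∈ p) → p = x) ∧
      (∀ i, T (L i).asIdeal) ∧ L.last.asIdeal = x ∧ L.length = n + c := by
  obtain ⟨hX, hXc⟩ := h2 x hx hT
  have hJX : J.map φ ≤ x.map φ := Ideal.map_mono hJx
  let m := Ideal.Quotient.mk (J.map φ)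
  have hm : Function.Surjective m := Ideal.Quotient.mk_surjective
  have hcm : ∀ P : Ideal F, J.map φ ≤ P → (P.map m).comap m = P := by
    intro P hP
    rw [Ideal.comap_map_of_surjective _ hm, ← RingHom.ker_eq_comap_bot, Ideal.mk_ker, sup_eq_left.mpr hP]
  have hpr : ∀ P : Ideal F, P.IsPrime → J.map φ ≤ P → (P.map m).IsPrime := fun P hP h =>
    Ideal.map_isPrime_of_surjective hm (by rw [Ideal.mk_ker]; exact h)
  have hXm := hpr _ hX hJX
  obtain ⟨s, hs, hc⟩ := Ideal.exists_finset_card_eq_height_of_isNoetherianRing ((x.map φ).map m)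
  choose z hz using fun i : s => hm i.1
  choose u hu a ha using fun i : s => h1 (z i)
  let e := s.equivFin
  have hzX : ∀ i, z i ∈ x.map φ := by
    intro i
    rw [← hcm _ hJX, Ideal.mem_comap, hz]
    exact hs.1.2 (Ideal.subset_span i.2)
  -- chain
  have hch : ((n + s.card : ℕ) : ℕ∞) ≤ Order.height (⟨x.map φ, hX⟩ : PrimeSpectrum F) := by
    have h4 : (s.card : ℕ∞) ≤ Order.height (⟨(x.map φ).map m, hXm⟩ : PrimeSpectrum (F ⧸ J.map φ)) := by
      rw [hc]
      exact ((⟨(x.map φ).map m, hXm⟩ : PrimeSpectrum (F ⧸ J.map φ)).height_eq_orderHeight).le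
    obtain ⟨L, hL, hLc⟩ := Order.exists_series_of_le_height _ h4
    have hmono : StrictMono (PrimeSpectrum.comap m) := by
      refine Monotone.strictMono_of_injective ?_ (PrimeSpectrum.comap_injective_of_surjective _ hm)
      intro P Q h
      exact Ideal.comap_mono h
    let L' := L.map _ hmono
    have hlast : L'.last = ⟨x.map φ, hX⟩ := by
      rw [LTSeries.last_map, hL]
      apply PrimeSpectrum.ext
      exact hcm _ hJX
    have hhead : J.map φ ≤ L'.head.asIdeal := by
      rw [LTSeries.head_map]
      intro y hy
      change m y ∈ L.head.asIdeal
      rw [show m y = 0 from Ideal.Quotient.eq_zero_iff_mem.mpr hy]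
      exact zero_mem _
    obtain ⟨M, hM, hML⟩ := Ideal.exists_minimalPrimes_le hhead
    have hhl : L'.head ≤ L'.last := L'.head_le_last
    rw [hlast] at hhl
    have h5 := hfib M hM (hML.trans hhl)
    have hMp := hM.1.1
    have h6 : (n : ℕ∞) ≤ Order.height L'.head := by
      rw [← h5]
      exact ((⟨M, hMp⟩ : PrimeSpectrum F).height_eq_orderHeight).le.trans (Order.height_mono hML)
    have h7 := le_height_last L' n h6
    rw [hlast] at h7
    have : L'.length = s.card := hLc
    rwa [this] at h7
  obtain ⟨L, hL, hLc⟩ := Order.exists_series_of_le_height _ hch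
  have hmono : StrictMono (PrimeSpectrum.comap φ) := by
    refine Monotone.strictMono_of_injective (fun P Q h => Ideal.comap_mono h) ?_
    intro P Q h
    have h : P.asIdeal.comap φ = Q.asIdeal.comap φ := congrArg PrimeSpectrum.asIdeal h
    apply PrimeSpectrum.ext
    rw [← map_comap_of_units φ h1 P.asIdeal, h, map_comap_of_units φ h1]
  refine ⟨s.card, a ∘ e.symm, L.map _ hmono, ?_, ?_, ?_, ?_, ?_⟩
  · intro i
    change a (e.symm i) ∈ x
    rw [← hXc, Ideal.mem_comap, ← ha]
    exact Ideal.mul_mem_left _ _ (hzX _)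
  · intro p hp hJp hpx hTp hgp
    obtain ⟨hP, hPc⟩ := h2 p hp hTp
    have hJP : J.map φ ≤ p.map φ := Ideal.map_mono hJp
    have hle : (p.map φ).map m ≤ (x.map φ).map m := Ideal.map_mono (Ideal.map_mono hpx)
    have h8 : (p.map φ).map m = (x.map φ).map m := by
      refine le_antisymm hle (hs.2 ⟨hpr _ hP hJP, ?_⟩ hle)
      rw [Ideal.span_le]
      intro y hy
      have h9 := hgp (e ⟨y, hy⟩)
      rw [Function.comp_apply, e.symm_apply_apply] at h9
      have h10 : φ (u ⟨y, hy⟩) * z ⟨y, hy⟩ ∈ p.map φ := by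
        rw [ha]; exact Ideal.mem_map_of_mem _ h9
      rw [Ideal.unit_mul_mem_iff_mem _ (hu _)] at h10
      have h11 := Ideal.mem_map_of_mem m h10
      rwa [hz] at h11
    rw [← hPc, ← hcm _ hJP, h8, hcm _ hJX, hXc]
  · intro i
    exact h3 _ inferInstance
  · rw [LTSeries.last_map, hL]
    exact hXc
  · exact hLc

theorem primeHt_eq {S : Type*} [CommRing S] (p : Ideal S) [hp : p.IsPrime] : primeHt p = p.height := by
  unfold primeHt
  rw [iSup_pos hp]
  exact ((⟨p, hp⟩ : PrimeSpectrum S).height_eq_orderHeight).symm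

theorem fib_zero {B A : Type u} [CommRing B] [CommRing A] [Algebra B A] (q : Ideal B) (b : B) (hb : b ∈ q) :
    fiberIncl B A q (algebraMap B A b) = 0 := by
  have h0 : algebraMap B (FractionRing (B ⧸ q)) b = 0 := by
    rw [IsScalarTower.algebraMap_apply B (B ⧸ q) (FractionRing (B ⧸ q))]
    rw [Ideal.Quotient.algebraMap_eq, Ideal.Quotient.eq_zero_iff_mem.mpr hb, map_zero]
  rw [AlgHom.commutes, Algebra.TensorProduct.algebraMap_apply, h0, zero_tmul]

theorem fib_unit {B A : Type u} [CommRing B] [CommRing A] [Algebra B A] (q : Ideal B) [q.IsPrime] (b : B) (hb : b ∉ q) :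
    IsUnit (fiberIncl B A q (algebraMap B A b)) := by
  have h0 : IsUnit (algebraMap B (FractionRing (B ⧸ q)) b) := by
    rw [isUnit_iff_ne_zero, IsScalarTower.algebraMap_apply B (B ⧸ q) (FractionRing (B ⧸ q)), Ne,
      FaithfulSMul.algebraMap_eq_zero_iff]
    rwa [Ideal.Quotient.algebraMap_eq, Ideal.Quotient.eq_zero_iff_mem]
  rw [AlgHom.commutes, Algebra.TensorProduct.algebraMap_apply]
  exact h0.map (Algebra.TensorProduct.includeLeft : FractionRing (B ⧸ q) →ₐ[B] FractionRing (B ⧸ q) ⊗[B] A)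

theorem fib_surj {B A : Type u} [CommRing B] [CommRing A] [Algebra B A] (q : Ideal B) [q.IsPrime]
    (z : FractionRing (B ⧸ q) ⊗[B] A) :
    ∃ b : B, b ∉ q ∧ ∃ a, fiberIncl B A q (algebraMap B A b) * z = fiberIncl B A q a := by
  induction z with
  | zero => exact ⟨1, (Ideal.ne_top_iff_one q).mp (Ideal.IsPrime.ne_top inferInstance), 0, by simp⟩
  | tmul k a =>
    obtain ⟨r, ⟨s, hs⟩, h⟩ := IsLocalization.exists_mk'_eq (nonZeroDivisors (B ⧸ q)) k
    obtain ⟨r, rfl⟩ := Ideal.Quotient.mk_surjective r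
    obtain ⟨s, rfl⟩ := Ideal.Quotient.mk_surjective s
    have hs' : s ∉ q := by
      intro h
      exact nonZeroDivisors.ne_zero hs (Ideal.Quotient.eq_zero_iff_mem.mpr h)
    refine ⟨s, hs', algebraMap B A r * a, ?_⟩
    have hk : algebraMap B (FractionRing (B ⧸ q)) s * k = algebraMap B (FractionRing (B ⧸ q)) r := by
      rw [← h]
      exact IsLocalization.mk'_spec' (FractionRing (B ⧸ q)) (Ideal.Quotient.mk q r) ⟨Ideal.Quotient.mk q s, hs⟩
    rw [AlgHom.commutes, Algebra.TensorProduct.algebraMap_apply, Algebra.TensorProduct.tmul_mul_tmul, hk, one_mul,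
      map_mul, AlgHom.commutes, Algebra.TensorProduct.algebraMap_apply]
    change _ = _ * ((1 : FractionRing (B ⧸ q)) ⊗ₜ[B] a)
    rw [Algebra.TensorProduct.tmul_mul_tmul, one_mul, mul_one]
  | add y z hy hz =>
    obtain ⟨b, hb, a, ha⟩ := hy
    obtain ⟨b', hb', a', ha'⟩ := hz
    refine ⟨b * b', (inferInstance : q.IsPrime).mul_notMem hb hb', algebraMap B A b' * a + algebraMap B A b * a', ?_⟩
    rw [map_mul, map_mul, map_add, map_mul, map_mul, ← ha, ← ha']
    ring

theorem fib_map_comap {B A : Type u} [CommRing B] [CommRing A] [Algebra B A] (q : Ideal B) [q.IsPrime]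
    (P : Ideal (FractionRing (B ⧸ q) ⊗[B] A)) :
    (P.comap (fiberIncl B A q).toRingHom).map (fiberIncl B A q).toRingHom = P := by
  refine map_comap_of_units _ ?_ P
  intro z
  obtain ⟨b, hb, h⟩ := fib_surj q z
  exact ⟨_, fib_unit q b hb, h⟩

theorem fib_under {B A : Type u} [CommRing B] [CommRing A] [Algebra B A] (q : Ideal B) [q.IsPrime]
    (P : Ideal (FractionRing (B ⧸ q) ⊗[B] A)) (hP : P.IsPrime) :
    (P.comap (fiberIncl B A q).toRingHom).under B = q := by
  ext b
  constructor
  · intro h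
    by_contra hb
    exact hP.ne_top (Ideal.eq_top_of_isUnit_mem _ h (fib_unit q b hb))
  · intro h
    change fiberIncl B A q (algebraMap B A b) ∈ P
    rw [fib_zero q b h]
    exact P.zero_mem

theorem fib_prime {B A : Type u} [CommRing B] [CommRing A] [Algebra B A] (q : Ideal B) [q.IsPrime]
    (p : Ideal A) (hp : p.IsPrime) (hpq : p.under B = q) :
    (p.map (fiberIncl B A q).toRingHom).IsPrime ∧ (p.map (fiberIncl B A q).toRingHom).comap (fiberIncl B A q).toRingHom = p := by
  have hl : p.LiesOver q := ⟨hpq.symm⟩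
  have hinj : Function.Injective (algebraMap (B ⧸ q) (A ⧸ p)) := FaithfulSMul.algebraMap_injective _ _
  have hinj2 : Function.Injective ((algebraMap (A ⧸ p) (FractionRing (A ⧸ p))).comp (algebraMap (B ⧸ q) (A ⧸ p))) :=
    (FaithfulSMul.algebraMap_injective (A ⧸ p) (FractionRing (A ⧸ p))).comp hinj
  let f0 : FractionRing (B ⧸ q) →+* FractionRing (A ⧸ p) := IsFractionRing.lift hinj2
  let f : FractionRing (B ⧸ q) →ₐ[B] FractionRing (A ⧸ p) := { f0 with
    commutes' := by
      intro b
      change f0 (algebraMap B _ b) = _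
      rw [IsScalarTower.algebraMap_apply B (B ⧸ q) (FractionRing (B ⧸ q))]
      refine (IsFractionRing.lift_algebraMap hinj2 _).trans ?_
      rw [IsScalarTower.algebraMap_apply B (A ⧸ p) (FractionRing (A ⧸ p))]
      rfl }
  let g : A →ₐ[B] FractionRing (A ⧸ p) := (IsScalarTower.toAlgHom B (A ⧸ p) (FractionRing (A ⧸ p))).comp (Ideal.Quotient.mkₐ B p)
  let ψ : FractionRing (B ⧸ q) ⊗[B] A →ₐ[B] FractionRing (A ⧸ p) :=
    Algebra.TensorProduct.lift f g (fun _ _ => .all _ _)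
  have hψ : ∀ a, ψ (fiberIncl B A q a) = algebraMap (A ⧸ p) (FractionRing (A ⧸ p)) (Ideal.Quotient.mk p a) := by
    intro a
    change ψ (1 ⊗ₜ a) = _
    refine (Algebra.TensorProduct.lift_tmul f g _ 1 a).trans ?_
    rw [map_one, one_mul]; rfl
  have hk : (RingHom.ker ψ).comap (fiberIncl B A q).toRingHom = p := by
    ext a
    change ψ (fiberIncl B A q a) = 0 ↔ _
    rw [hψ, FaithfulSMul.algebraMap_eq_zero_iff, Ideal.Quotient.eq_zero_iff_mem]
  have hk2 : p.map (fiberIncl B A q).toRingHom = RingHom.ker ψ := by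
    rw [← fib_map_comap q (RingHom.ker ψ), hk]
  rw [hk2]
  exact ⟨RingHom.ker_isPrime _, hk⟩

theorem fib_max {B A : Type u} [CommRing B] [CommRing A] [Algebra B A] (q : Ideal B) [q.IsPrime]
    (p : Ideal A) (hp : p.IsPrime) (hpq : p.under B = q) :
    (p.map (fiberIncl B A q)).IsMaximal ↔ ∀ y : Ideal A, y.IsPrime → p ≤ y → y.under B = q → y = p := by
  change (p.map (fiberIncl B A q).toRingHom).IsMaximal ↔ _
  obtain ⟨h1, h2⟩ := fib_prime q p hp hpq
  constructor
  · intro hm y hy hpy hyq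
    obtain ⟨h3, h4⟩ := fib_prime q y hy hyq
    rw [← h2, ← h4, hm.eq_of_le h3.ne_top (Ideal.map_mono hpy)]
  · intro h
    obtain ⟨M, hM, hpM⟩ := Ideal.exists_le_maximal _ h1.ne_top
    have h5 := h (M.comap (fiberIncl B A q).toRingHom) inferInstance (by
      rw [← h2]; exact Ideal.comap_mono hpM) (fib_under q M hM.isPrime)
    rw [← h5, fib_map_comap]
    exact hM

theorem HF {B A : Type u} [CommRing B] [CommRing A] [Algebra B A] [Algebra.FiniteType B A]
    (J x : Ideal A) (hx : x.IsPrime) (q : Ideal B) [q.IsPrime] (hxq : x.under B = q) (hJx : J ≤ x) (n : ℕ)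
    (hfib : ∀ P : Ideal (TensorProduct B (FractionRing (B ⧸ q)) A),
      P ∈ (J.map (fiberIncl B A q)).minimalPrimes → P ≤ x.map (fiberIncl B A q) →
      primeHt (S := TensorProduct B (FractionRing (B ⧸ q)) A) P = (n : ℕ∞)) :
    ∃ (c : ℕ) (g : Fin c → A) (L : LTSeries (PrimeSpectrum A)), (∀ i, g i ∈ x) ∧
      (∀ p : Ideal A, p.IsPrime → J ≤ p → p ≤ x → p.under B = q → (∀ i, g i ∈ p) → p = x) ∧
      (∀ i, (L i).asIdeal.under B = q) ∧ L.last.asIdeal = x ∧ L.length = n + c := by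
  have : IsNoetherianRing (FractionRing (B ⧸ q) ⊗[B] A) :=
    Algebra.FiniteType.isNoetherianRing (FractionRing (B ⧸ q)) _
  refine HF_abstract (fiberIncl B A q).toRingHom (fun p => p.under B = q) ?_ (fib_prime q) (fib_under q)
    J x hx hxq hJx n ?_
  · intro z
    obtain ⟨b, hb, h⟩ := fib_surj q z
    exact ⟨_, fib_unit q b hb, h⟩
  · intro P hP hPx
    have := hP.1.1
    rw [← primeHt_eq]
    exact hfib P hP hPx

theorem flat_loc {B A S : Type u} [CommRing B] [CommRing A] [Algebra B A] [CommRing S] [Algebra A S] [Algebra B S]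
    [IsScalarTower B A S] (M : Submonoid A) [IsLocalization M S] (I : Ideal A) [Module.Flat B (A ⧸ I)] :
    Module.Flat B (S ⧸ I.map (algebraMap A S)) := by
  have h : Module.Flat (A ⧸ I) (S ⧸ I.map (algebraMap A S)) :=
    IsLocalization.flat _ (Algebra.algebraMapSubmonoid (A ⧸ I) M)
  have : IsScalarTower B (A ⧸ I) (S ⧸ I.map (algebraMap A S)) := by
    refine IsScalarTower.of_algebraMap_eq fun b => ?_
    change Ideal.Quotient.mk _ (algebraMap B S b) = Ideal.Quotient.mk _ (algebraMap A S (algebraMap B A b))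
    rw [← IsScalarTower.algebraMap_apply]
  exact Module.Flat.trans B (A ⧸ I) _

theorem height_loc {A S : Type u} [CommRing A] [CommRing S] [Algebra A S] (M : Submonoid A) [IsLocalization M S]
    (I : Ideal A) (j : ℕ) (h : ∀ p ∈ I.minimalPrimes, p.height ≤ j) :
    ∀ p ∈ (I.map (algebraMap A S)).minimalPrimes, p.height ≤ j := by
  intro p hp
  have hp' := hp
  rw [IsLocalization.minimalPrimes_map M] at hp'
  have := hp.1.1
  rw [← IsLocalization.height_under M p]
  exact h _ hp'

theorem smooth_case {B A S : Type u} [CommRing B] [IsDomain B] [CommRing A] [Algebra B A] [Algebra.FiniteType B A]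
    [CommRing S] [Algebra A S] [Algebra B S] [IsScalarTower B A S] [Algebra.FiniteType B S]
    (M : Submonoid A) [IsLocalization M S]
    (d : ℕ)
    [Algebra (MvPolynomial (Fin d) B) S] [IsScalarTower B (MvPolynomial (Fin d) B) S]
    [Module.Flat (MvPolynomial (Fin d) B) S]
    [Algebra.FormallyUnramified (MvPolynomial (Fin d) B) S] [Algebra.EssFiniteType (MvPolynomial (Fin d) B) S]
    (I I' : Ideal A) (j j' : ℕ)
    [Module.Flat B (A ⧸ I)] [Module.Flat B (A ⧸ I')]
    (hI : ∀ p ∈ I.minimalPrimes, p.height ≤ j) (hI' : ∀ p ∈ I'.minimalPrimes, p.height ≤ j')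
    (x : Ideal A) [x.IsPrime] (hMx : Disjoint (M : Set A) x)
    (hIx : I ≤ x) (hI'x : I' ≤ x) (q : Ideal B) [q.IsPrime] [hxl : x.LiesOver q]
    (c : ℕ) (g : Fin c → A) (hg : ∀ i, g i ∈ x)
    (huniq : ∀ p : Ideal A, p.IsPrime → I ≤ p → I' ≤ p → p ≤ x → p.under B = q → (∀ i, g i ∈ p) → p = x)
    (L : LTSeries (PrimeSpectrum A)) (hL : ∀ i, (L i).asIdeal.under B = q) (hLx : L.last.asIdeal = x)
    (hlen : L.length = j + j' + c) (q' : Ideal B) [q'.IsPrime] (hq' : q' ≤ q) :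
    ∃ p : Ideal A, p.IsPrime ∧ I ≤ p ∧ I' ≤ p ∧ p ≤ x ∧ p.under B = q' ∧
      ((∀ y : Ideal A, y.IsPrime → x ≤ y → y.under B = q → y = x) →
        ∀ y : Ideal A, y.IsPrime → p ≤ y → y.under B = q' → y = p) := by
  have hu : ∀ y : Ideal S, (y.under A).under B = y.under B := fun y => Ideal.under_under y
  have hmu : ∀ y : Ideal S, (y.under A).map (algebraMap A S) = y := fun y => IsLocalization.map_under M S y
  have hd : ∀ y : Ideal A, y ≤ x → Disjoint (M : Set A) y := fun y hy => hMx.mono_right hy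
  have hpr : ∀ y : Ideal A, y.IsPrime → y ≤ x → (y.map (algebraMap A S)).IsPrime := fun y hy h =>
    IsLocalization.isPrime_of_isPrime_disjoint M S y hy (hd y h)
  have hum : ∀ y : Ideal A, y.IsPrime → y ≤ x → (y.map (algebraMap A S)).under A = y := fun y hy h =>
    IsLocalization.under_map_of_isPrime_disjoint M S hy (hd y h)
  have hle : ∀ (y : Ideal A) (z : Ideal S), y.map (algebraMap A S) ≤ z ↔ y ≤ z.under A := fun y z =>
    Ideal.map_le_iff_le_comap
  have hxp := hpr x inferInstance le_rfl
  have hxx := hum x inferInstance le_rfl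
  have hxS : (x.map (algebraMap A S)).LiesOver q := ⟨by rw [← hu, hxx]; exact hxl.over⟩
  have := flat_loc (B := B) (S := S) M I
  have := flat_loc (B := B) (S := S) M I'
  have hLle : ∀ i, (L i).asIdeal ≤ x := by
    intro i
    rw [← hLx]
    exact L.monotone (Fin.le_last i)
  let L' : LTSeries (PrimeSpectrum S) :=
    { length := L.length
      toFun := fun i => ⟨(L i).asIdeal.map (algebraMap A S), hpr _ inferInstance (hLle i)⟩
      step := by
        intro i
        have h1 := L.step i
        change (L i.castSucc) < (L i.succ) at h1
        have h2 : (L i.castSucc).asIdeal.map (algebraMap A S) ≤ (L i.succ).asIdeal.map (algebraMap A S) :=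
          Ideal.map_mono h1.le
        refine lt_of_le_of_ne h2 ?_
        intro h3
        have h3 : ((L i.castSucc).asIdeal.map (algebraMap A S)).under A =
          ((L i.succ).asIdeal.map (algebraMap A S)).under A := congrArg (Ideal.under A) h3
        rw [hum _ inferInstance (hLle _), hum _ inferInstance (hLle _)] at h3
        exact h1.ne (PrimeSpectrum.ext h3) }
  obtain ⟨p, hp, hIp, hI'p, hpx, hpq, hpm⟩ := etale_case d (I.map (algebraMap A S)) (I'.map (algebraMap A S)) j j'
    (height_loc M I j hI) (height_loc M I' j' hI') (x.map (algebraMap A S)) (Ideal.map_mono hIx)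
    (Ideal.map_mono hI'x) q c (fun i => algebraMap A S (g i)) (fun i => Ideal.mem_map_of_mem _ (hg i))
    (by
      intro p hp h1 h2 h3 h4 h5
      rw [← hmu p]
      congr 1
      refine huniq _ inferInstance ((hle _ _).mp h1) ((hle _ _).mp h2) ?_ ?_ h5
      · rw [← hxx]; exact Ideal.comap_mono h3
      · rw [hu, h4])
    L' (by
      intro i
      change ((L i).asIdeal.map (algebraMap A S)).under B = q
      rw [← hu, hum _ inferInstance (hLle i)]; exact hL i)
    (by rw [← hLx]; rfl) hlen q' hq'
  refine ⟨p.under A, inferInstance, (hle _ _).mp hIp, (hle _ _).mp hI'p, ?_, ?_, ?_⟩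
  · rw [← hxx]; exact Ideal.comap_mono hpx
  · rw [hu, hpq]
  · intro hmax
    have h1 := hpm (by
      intro y hy hxy hyq
      rw [← hmu y]
      congr 1
      exact hmax _ inferInstance ((hle _ _).mp hxy) (by rw [hu, hyq]))
    have : p.LiesOver q' := ⟨hpq.symm⟩
    have : (p.under A).LiesOver q' := ⟨by rw [hu, hpq]⟩
    rw [qf_of_max] at h1 ⊢
    have hst : IsScalarTower (B ⧸ q') (A ⧸ p.under A) (S ⧸ p) := by
      refine IsScalarTower.of_algebraMap_eq fun b => ?_
      obtain ⟨b, rfl⟩ := Ideal.Quotient.mk_surjective b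
      change Ideal.Quotient.mk _ (algebraMap B S b) = Ideal.Quotient.mk _ (algebraMap A S (algebraMap B A b))
      rw [← IsScalarTower.algebraMap_apply]
    exact Algebra.IsAlgebraic.of_injective (IsScalarTower.toAlgHom (B ⧸ q') (A ⧸ p.under A) (S ⧸ p))
      (FaithfulSMul.algebraMap_injective (A ⧸ p.under A) (S ⧸ p))


end Helpers

/-- **Lifting proper intersections over an arbitrary base (affine form).**
Let `B` be a domain, `A` a smooth `B`-algebra, and `I`, `I'` ideals with `A/I`, `A/I'` flat
over `B`, all minimal primes of `I` of height `≤ j` and of `I'` of height `≤ j'`.  Let `q` be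
a prime of `B` with residue field `κ(q) = Frac(B ⧸ q)`, and let `x ⊇ I + I'` be a prime of
`A` lying over `q` such that in the fiber ring `A ⊗_B κ(q)` every prime minimal over the
image of `I + I'` and contained in the image of `x` has height `j + j'`.  Then for every
prime `q' ⊆ q` of `B`: (1) there is a prime `p` of `A` with `I + I' ⊆ p ⊆ x` lying over
`q'`; (2) if the image of `x` in `A ⊗_B κ(q)` is maximal, `p` may be chosen so that its
image generates a maximal ideal of `A ⊗_B κ(q')`. -/
theorem lift_proper_intersection_over_arbitrary_base
    {B A : Type u} [CommRing B] [IsDomain B] [CommRing A] [Algebra B A]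
    [Algebra.FormallySmooth B A] [Algebra.FinitePresentation B A]
    (I I' : Ideal A) (j j' : ℕ)
    (hIflat : Module.Flat B (A ⧸ I)) (hI'flat : Module.Flat B (A ⧸ I'))
    (hIht : ∀ p ∈ I.minimalPrimes, primeHt p ≤ (j : ℕ∞))
    (hI'ht : ∀ p ∈ I'.minimalPrimes, primeHt p ≤ (j' : ℕ∞))
    (q : Ideal B) (hq : q.IsPrime)
    (x : Ideal A) (hx : x.IsPrime) (hxII' : I + I' ≤ x)
    (hxq : x.comap (algebraMap B A) = q)
    (hfib : ∀ P : Ideal (TensorProduct B (FractionRing (B ⧸ q)) A),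
      P ∈ ((I + I').map (fiberIncl B A q)).minimalPrimes →
      P ≤ x.map (fiberIncl B A q) →
      primeHt (S := TensorProduct B (FractionRing (B ⧸ q)) A) P = ((j + j' : ℕ) : ℕ∞)) :
    ∀ (q' : Ideal B), q'.IsPrime → q' ≤ q →
      (∃ p : Ideal A, p.IsPrime ∧ I + I' ≤ p ∧ p ≤ x ∧ p.comap (algebraMap B A) = q') ∧
      ((x.map (fiberIncl B A q)).IsMaximal →
        ∃ p : Ideal A, p.IsPrime ∧ I + I' ≤ p ∧ p ≤ x ∧ p.comap (algebraMap B A) = q' ∧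
          (p.map (fiberIncl B A q')).IsMaximal) := by
  have hxq' : x.under B = q := hxq
  have hxl : x.LiesOver q := ⟨hxq.symm⟩
  obtain ⟨c, g, L, hg, huniq, hL, hLx, hlen⟩ := HF (I + I') x hx q hxq' hxII' (j + j') hfib
  have hsm : Algebra.IsSmoothAt B x := Algebra.FormallySmooth.comp B A (Localization.AtPrime x)
  obtain ⟨f, hfx, d, hd, hst, hse⟩ := Algebra.IsSmoothAt.exists_isStandardEtale_mvPolynomial (R := B) (p := x)
  have hft : Algebra.FiniteType B (Localization.Away f) :=
    Algebra.FiniteType.trans (S := A) inferInstance (IsLocalization.finiteType_of_monoid_fg (.powers f) _)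
  have : Module.Flat (MvPolynomial (Fin d) B) (Localization.Away f) := Algebra.Smooth.flat _ _
  have hsum : ∀ p : Ideal A, I + I' ≤ p ↔ I ≤ p ∧ I' ≤ p := fun p => sup_le_iff
  intro q' hq'p hq'
  obtain ⟨p, hp, hIp, hI'p, hpx, hpq, hpm⟩ := smooth_case (S := Localization.Away f) (.powers f) d I I' j j'
    (fun p hp => by
      have := hp.1.1
      rw [← primeHt_eq]; exact hIht p hp)
    (fun p hp => by
      have := hp.1.1
      rw [← primeHt_eq]; exact hI'ht p hp)
    x (by
      rw [Set.disjoint_left]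
      rintro _ ⟨n, rfl⟩ h
      exact hfx (hx.mem_of_pow_mem n h))
    ((hsum x).mp hxII').1 ((hsum x).mp hxII').2 q c g hg
    (fun p hp h1 h2 => huniq p hp ((hsum p).mpr ⟨h1, h2⟩)) L hL hLx hlen q' hq'
  refine ⟨⟨p, hp, (hsum p).mpr ⟨hIp, hI'p⟩, hpx, hpq⟩, fun hmax => ⟨p, hp, (hsum p).mpr ⟨hIp, hI'p⟩, hpx, hpq, ?_⟩⟩
  exact (fib_max q' p hp hpq).mpr (hpm ((fib_max q x hx hxq').mp hmax))
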